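/- Difference equations of the Tratnik polynomials of q-Racah type: for all nonnegative integers x, y, i, j with x+y ≤ N and i+j ≤ N, one has (i) λ(j;c₄c₀)·T_{i,j}(x,y) = Σ_{ε∈{−1,0,+1}} Φ^{ε}(y;c₄,c₀,c₃;N−x)·T_{i,j}(x,y−ε), and (ii) λ(i;c₂c₃)·T_{i,j}(x,y) = Σ_{ε,ε'∈{−1,0,+1}} A^{ε,ε'}_{y,x}(c₄,c₀,c₃,c₁;N)·T_{i,j}(x−ε',y−ε), where the superscripts of Φ and A are +, 0, − according as the shift is +1, 0, −1. (For the parameter list (c₄,c₀,c₃,c₁) the induced fifth parameter occurring in the definition of A equals c₂.) -/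

import Mathlib

noncomputable section
namespace qR

/-- q-Pochhammer symbol `(a;q)_k = ∏_{l<k} (1 - a qˡ)`. -/
def poch (q a : ℂ) (k : ℕ) : ℂ := ∏ l ∈ Finset.range k, (1 - a * q ^ l)

/-- q-binomial coefficient, zero outside `0 ≤ n ≤ N`. -/
def binom (q : ℂ) (N n : ℤ) : ℂ :=
  if 0 ≤ n ∧ n ≤ N then poch q q N.toNat / (poch q q n.toNat * poch q q (N - n).toNat) else 0

/-- Normalisation `Ω(n;c1,c2,c3;N)`; `s` and `t2` are the chosen square roots of `q` and `c2`,
so that `(q c2)^(n - N/2) = (s t2)^(2n - N)`. -/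
def Om (q s c1 c2 c3 t2 : ℂ) (N n : ℤ) : ℂ :=
  binom q N n * (1 - c2 * c3 * q ^ (2 * n + 1)) * poch q (q * c2) n.toNat
      * poch q (c1 * c2 * c3 * q ^ (N + 2)) n.toNat * poch q (q * c1) (N - n).toNat
    / ((s * t2) ^ (2 * n - N) * poch q (c2 * c3 * q ^ (n + 1)) (N + 1).toNat
        * poch q (q * c3) n.toNat)

/-- Normalised q-Racah polynomial `p_n(x;c1,c2,c3;N)`, with the convention that it
vanishes unless `0 ≤ n ≤ N` and `0 ≤ x ≤ N`. -/
def p (q s c1 c2 c3 t2 : ℂ) (N n x : ℤ) : ℂ :=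
  if 0 ≤ n ∧ n ≤ N ∧ 0 ≤ x ∧ x ≤ N then
    Om q s c1 c2 c3 t2 N n *
      ∑ k ∈ Finset.range (n.toNat + 1),
        poch q (q ^ (-n)) k * poch q (c2 * c3 * q ^ (n + 1)) k * poch q (q ^ (-x)) k
            * poch q (c1 * c2 * q ^ (x + 1)) k * q ^ k
          / (poch q (q * c2) k * poch q (c1 * c2 * c3 * q ^ (N + 2)) k
              * poch q (q ^ (-N)) k * poch q q k)
  else 0

/-- `ω_n(c) = (-1)^n c^{n/2} q^{n(n+1)/2}`, where `r` is the chosen square root of `c`. -/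
def om (q r : ℂ) (n : ℤ) : ℂ := (-1 : ℂ) ^ n * r ^ n * q ^ (n * (n + 1) / 2)

/-- `ξ_n(c1,c2) = ((qc1;q)_n/(qc2;q)_n) (c2/c1)^{n/2}`, where `t1, t2` are the chosen
square roots of `c1, c2`. -/
def xi (q c1 c2 t1 t2 : ℂ) (n : ℤ) : ℂ :=
  poch q (q * c1) n.toNat / poch q (q * c2) n.toNat * (t2 / t1) ^ n

/-- `λ(x;c) = -(1-q^{-x})(1-c q^{x+1})`. -/
def lam (q c : ℂ) (x : ℤ) : ℂ := -(1 - q ^ (-x)) * (1 - c * q ^ (x + 1))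

def PhiP (q c1 c2 c3 : ℂ) (N n : ℤ) : ℂ :=
  -c2 * q ^ (n - N) * (1 - q ^ n) * (1 - c1 * q ^ (N - n + 1)) * (1 - c2 * c3 * q ^ (n + N + 1))
      * (1 - c3 * q ^ n)
    / ((1 - c2 * c3 * q ^ (2 * n)) * (1 - c2 * c3 * q ^ (2 * n + 1)))

def PhiM (q c1 c2 c3 : ℂ) (N n : ℤ) : ℂ :=
  (1 - q ^ (n - N)) * (1 - c1 * c2 * c3 * q ^ (n + N + 2)) * (1 - c2 * q ^ (n + 1))
      * (1 - c2 * c3 * q ^ (n + 1))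
    / ((1 - c2 * c3 * q ^ (2 * n + 1)) * (1 - c2 * c3 * q ^ (2 * n + 2)))

/-- `Φ^ε(n;c1,c2,c3;N)`, where `ε = 1, -1, 0` selects `Φ⁺, Φ⁻, Φ⁰`. -/
def Phi (q c1 c2 c3 : ℂ) (N ε n : ℤ) : ℂ :=
  if ε = 1 then PhiP q c1 c2 c3 N n
  else if ε = -1 then PhiM q c1 c2 c3 N n
  else -PhiP q c1 c2 c3 N n - PhiM q c1 c2 c3 N n

/-- `λ₊(x;c1,c2,c3;N)`. -/
def lamP (q c1 c2 c3 : ℂ) (N x : ℤ) : ℂ :=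
  -(q ^ (-N - 1) / c3 - q ^ (-x)) * (1 - c1 * c2 * c3 * q ^ (N + x + 2))

/-- `λ₋(x;c1,c2,c3;N)`. -/
def lamM (q c1 c2 c3 : ℂ) (N x : ℤ) : ℂ :=
  -(q ^ (-N) - q ^ (-x)) * (1 - c1 * c2 * q ^ (N + x + 1))

def PhiPp (q sq c1 c2 c3 : ℂ) (N n : ℤ) : ℂ :=
  -sq * c2 * q ^ (2 * n - N - 1) * (1 - q ^ n) * (1 - c1 * q ^ (N - n + 1))
      * (1 - c1 * q ^ (N + 2 - n)) * (1 - c3 * q ^ n)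
    / ((1 - c2 * c3 * q ^ (2 * n)) * (1 - c2 * c3 * q ^ (2 * n + 1)))

def PhiPm (q sq c1 c2 c3 : ℂ) (N n : ℤ) : ℂ :=
  -((1 - c1 * c2 * c3 * q ^ (n + N + 2)) * (1 - c1 * c2 * c3 * q ^ (n + N + 3))
      * (1 - c2 * q ^ (n + 1)) * (1 - c2 * c3 * q ^ (n + 1)))
    / (c3 * q ^ (N + 1) * sq * (1 - c2 * c3 * q ^ (2 * n + 1)) * (1 - c2 * c3 * q ^ (2 * n + 2)))

def PhiP0 (q sq c1 c2 c3 : ℂ) (N n : ℤ) : ℂ :=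
  -PhiPp q sq c1 c2 c3 N n - PhiPm q sq c1 c2 c3 N n
    - (1 - c1 * c2 * q ^ (N + 2)) * (1 - c1 * c2 * c3 * q ^ (N + 2)) / (c3 * q ^ (N + 1) * sq)

def PhiMp (q sq c1 c2 c3 : ℂ) (N n : ℤ) : ℂ :=
  -sq * (1 - q ^ n) * (1 - c3 * q ^ n) * (1 - c2 * c3 * q ^ (n + N))
      * (1 - c2 * c3 * q ^ (n + N + 1))
    / (q ^ N * (1 - c2 * c3 * q ^ (2 * n)) * (1 - c2 * c3 * q ^ (2 * n + 1)))

def PhiMm (q sq c1 c2 c3 : ℂ) (N n : ℤ) : ℂ :=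
  -c3 * sq * q ^ N * (1 - q ^ (n - N)) * (1 - q ^ (n - N + 1)) * (1 - c2 * q ^ (n + 1))
      * (1 - c2 * c3 * q ^ (n + 1))
    / ((1 - c2 * c3 * q ^ (2 * n + 1)) * (1 - c2 * c3 * q ^ (2 * n + 2)))

def PhiM0 (q sq c1 c2 c3 : ℂ) (N n : ℤ) : ℂ :=
  -PhiMp q sq c1 c2 c3 N n - PhiMm q sq c1 c2 c3 N n - sq * (1 - c3 * q ^ N) * (q ^ (-N) - 1)

/-- Contiguity coefficient `Φ_σ^ε(n;c1,c2,c3;N)`, where `σ = 1` is the `+` and `σ = -1`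
the `-` family, `ε ∈ {1,0,-1}` selects the superscript, and `sq` is the chosen square
root of `q c2`. -/
def PhiC (q sq c1 c2 c3 : ℂ) (σ ε N n : ℤ) : ℂ :=
  if σ = 1 then
    if ε = 1 then PhiPp q sq c1 c2 c3 N n
    else if ε = -1 then PhiPm q sq c1 c2 c3 N n
    else PhiP0 q sq c1 c2 c3 N n
  else
    if ε = 1 then PhiMp q sq c1 c2 c3 N n
    else if ε = -1 then PhiMm q sq c1 c2 c3 N n
    else PhiM0 q sq c1 c2 c3 N n

def Fp (q c1 c2 : ℂ) (x : ℤ) : ℂ :=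
  c1 * c2 ^ 2 * q ^ (x + 1) * (1 - c1 * q ^ x) * (1 - q ^ x)
    / ((1 - c1 * c2 * q ^ (2 * x)) * (1 - c1 * c2 * q ^ (2 * x + 1)))

def Fm (q c1 c2 : ℂ) (x : ℤ) : ℂ :=
  c1 * c2 * q ^ (x + 1) * (1 - c2 * q ^ (x + 1)) * (1 - c1 * c2 * q ^ (x + 1))
    / ((1 - c1 * c2 * q ^ (2 * x + 1)) * (1 - c1 * c2 * q ^ (2 * x + 2)))

/-- The coefficients `A^{ε,ε'}_{i,j}(c1,c2,c3,c4;N)` for `(ε,ε') ≠ (0,0)`;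
`t2` is the chosen square root of `c2` and the fifth parameter
`c0 = (q^{2N+3} c1 c2 c3 c4)⁻¹` is computed internally. -/
def Aaux (q s c1 c2 c3 c4 t2 : ℂ) (N ε ε' i j : ℤ) : ℂ :=
  if ε' = 1 ∨ ε' = -1 then
    -c3 * q ^ (N + 1) *
        (if ε' = 1 then Fp q c4 ((q ^ (2 * N + 3) * c1 * c2 * c3 * c4)⁻¹) j
         else Fm q c4 ((q ^ (2 * N + 3) * c1 * c2 * c3 * c4)⁻¹) j) *
        PhiC q (s * t2) c1 c2 c3 ε' ε (N - j) i
  else if ε = 1 ∨ ε = -1 then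
    c3 * q ^ (N + 1) *
        (Fp q c4 ((q ^ (2 * N + 3) * c1 * c2 * c3 * c4)⁻¹) j
          + Fm q c4 ((q ^ (2 * N + 3) * c1 * c2 * c3 * c4)⁻¹) j) *
        Phi q c1 c2 c3 (N - j) ε i
  else 0

/-- The coefficients `A^{ε,ε'}_{i,j}(c1,c2,c3,c4;N)`. -/
def A (q s c1 c2 c3 c4 t2 : ℂ) (N ε ε' i j : ℤ) : ℂ :=
  if ε = 0 ∧ ε' = 0 then
    -((1 - c3 * q ^ (N + 1 - j)) * (s * t2) / (1 - c1 * c2 * q ^ (N + 2 - j)))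
          * ∑ e ∈ ({-1, 0, 1} : Finset ℤ), Aaux q s c1 c2 c3 c4 t2 N e 1 i j
      - (1 - c1 * c2 * q ^ (N + 1 - j)) / ((1 - c3 * q ^ (N - j)) * (s * t2))
          * ∑ e ∈ ({-1, 0, 1} : Finset ℤ), Aaux q s c1 c2 c3 c4 t2 N e (-1) i j
      - ∑ e ∈ ({-1, 1} : Finset ℤ), Aaux q s c1 c2 c3 c4 t2 N e 0 i j
  else Aaux q s c1 c2 c3 c4 t2 N ε ε' i j

/-- `Λ(x;c1,c2,c3,c4;N)`; `s, t1, t2, t3, t4` are the chosen square roots of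
`q, c1, c2, c3, c4`. -/
def Lam (q s c1 c2 c3 c4 t1 t2 t3 t4 : ℂ) (N x : ℤ) : ℂ :=
  (-1 : ℂ) ^ x * binom q N x * (1 - c1 * c2 * q ^ (2 * x + 1)) * poch q (q * c2) x.toNat
      * (s * t2) ^ N * (t1 * t3 / (t2 * t4)) ^ x * q ^ (x * (x - 1) / 2)
    / (poch q (q * c1) x.toNat * poch q (q ^ (x + 1) * c1 * c2) (N + 1).toNat)

/-- Tratnik polynomial of q-Racah type `T_{i,j}(x,y;c1,c2,c3,c4;N)`; the fifth parameter
`c0 = (q^{2N+3} c1 c2 c3 c4)⁻¹` and its square root `t0 = (s^{2N+3} t1 t2 t3 t4)⁻¹`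
are computed internally. -/
def T (q s c1 c2 c3 c4 t1 t2 t3 t4 : ℂ) (N i j x y : ℤ) : ℂ :=
  if 0 ≤ i ∧ 0 ≤ j ∧ i + j ≤ N then
    p q s c1 c2 c3 t2 (N - j) i x *
      p q s c3 ((q ^ (2 * N + 3) * c1 * c2 * c3 * c4)⁻¹) c4
        ((s ^ (2 * N + 3) * t1 * t2 * t3 * t4)⁻¹) (N - x) j y
  else 0

/-- Griffiths polynomial of q-Racah type `G_{i,j}(x,y;c1,c2,c3,c4;N)`; the fifth parameter
`c0 = (q^{2N+3} c1 c2 c3 c4)⁻¹` and its square root `t0 = (s^{2N+3} t1 t2 t3 t4)⁻¹`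
are computed internally. -/
def G (q s c1 c2 c3 c4 t1 t2 t3 t4 : ℂ) (N i j x y : ℤ) : ℂ :=
  if 0 ≤ i ∧ 0 ≤ j ∧ i + j ≤ N then
    ∑ a ∈ Finset.range ((min (N - j) (N - y)).toNat + 1),
      om q (t1 * t2 * t3 / t4) (a : ℤ) * p q s c1 c2 c3 t2 (N - j) i (a : ℤ) *
        p q s c3 ((q ^ (2 * N + 3) * c1 * c2 * c3 * c4)⁻¹) c4
          ((s ^ (2 * N + 3) * t1 * t2 * t3 * t4)⁻¹) (N - (a : ℤ)) j y *
        p q s c4 c2 c1 t2 (N - y) (a : ℤ) x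
  else 0

theorem poch_zero (q a : ℂ) : poch q a 0 = 1 := by simp [poch]
theorem poch_succ (q a : ℂ) (k : ℕ) : poch q a (k+1) = poch q a k * (1 - a * q^k) := by
  simp [poch, Finset.prod_range_succ]
theorem poch_succ' (q a : ℂ) (k : ℕ) : poch q a (k+1) = (1 - a) * poch q (a*q) k := by
  unfold poch
  rw [Finset.prod_range_succ', mul_comm]
  simp only [pow_zero, mul_one]
  congr 1
  apply Finset.prod_congr rfl
  intros; ring
theorem poch_shift (q a : ℂ) (k : ℕ) : (1 - a) * poch q (a*q) k = poch q a k * (1 - a * q^k) := by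
  rw [← poch_succ', poch_succ]

theorem poch_ne (q a : ℂ) (k : ℕ) (h : ∀ l, l < k → 1 - a * q^l ≠ 0) : poch q a k ≠ 0 := by
  unfold poch
  rw [Finset.prod_ne_zero_iff]
  intro l hl
  exact h l (Finset.mem_range.1 hl)

def ph (q G X : ℂ) (k : ℕ) : ℂ := poch q X⁻¹ k * poch q (G * q * X) k

theorem ph_zero (q G X : ℂ) : ph q G X 0 = 1 := by simp [ph, poch_zero]

theorem ph_succ (q G X : ℂ) (k : ℕ) :
    ph q G X (k+1) = ph q G X k * ((1 - q^k/X) * (1 - G*q^(k+1)*X)) := by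
  simp only [ph, poch_succ]; ring

theorem ph_down (q G X : ℂ) (hq : q ≠ 0) (hX : X ≠ 0) (k : ℕ) :
    (1 - X) * ph q G (X/q) (k+1) =
      (1 - X) * ph q G X (k+1) - (1 - q^k/X)*(1-q^(k+1))*(1-G*X^2) * ph q G X k := by
  have e1 : (X/q)⁻¹ = X⁻¹ * q := by field_simp
  have e2 : G*q*(X/q) = G*X := by field_simp
  have e3 : G*X*q = G*q*X := by ring
  have h1 := poch_shift q X⁻¹ (k+1)
  have h2 : (1 - X) * poch q (X⁻¹*q) (k+1) = -X * (poch q X⁻¹ k * (1 - X⁻¹*q^k) * (1 - X⁻¹*q^(k+1))) := by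
    rw [← poch_succ, ← h1]; field_simp; ring
  rw [ph_succ q G X]
  unfold ph
  rw [e1, e2, poch_succ' q (G*X), e3]
  calc _ = ((1 - X) * poch q (X⁻¹*q) (k+1)) * ((1-G*X) * poch q (G*q*X) k) := by ring
    _ = _ := by rw [h2]; field_simp; ring

theorem ph_up (q G X : ℂ) (hq : q ≠ 0) (hX : X ≠ 0) (k : ℕ) :
    (1 - G*q*X) * ph q G (X*q) (k+1) =
      (1 - G*q*X) * ph q G X (k+1) - (1 - G*q^(k+1)*X)*(1-q^(k+1))*(1-G*q^2*X^2)/(q*X) * ph q G X k := by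
  have e1 : X⁻¹ = (X*q)⁻¹ * q := by field_simp
  have e2 : G*q*(X*q) = (G*q*X)*q := by ring
  have h1 := poch_shift q (G*q*X) (k+1)
  have h2 : poch q (X*q)⁻¹ (k+1) = (1 - (X*q)⁻¹) * poch q X⁻¹ k := by
    rw [poch_succ', ← e1]
  rw [ph_succ q G X]
  unfold ph
  rw [e2, h2]
  calc _ = ((1 - G*q*X) * poch q (G*q*X*q) (k+1)) * ((1 - (X*q)⁻¹) * poch q X⁻¹ k) := by ring
    _ = _ := by rw [h1, poch_succ]; field_simp; ring

/-- generic step -/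
theorem gstep (q G X u v U V κ0 μ ν : ℂ) (hq : q ≠ 0) (hX : X ≠ 0) (k : ℕ)
    (d0 : 1 - G*X^2 ≠ 0) (d1 : 1 - G*q*X^2 ≠ 0) (d2 : 1 - G*q^2*X^2 ≠ 0)
    (hu : u = U / ((1 - G*X^2)*(1 - G*q*X^2)))
    (hv : v = V / ((1 - G*q*X^2)*(1 - G*q^2*X^2)))
    (hid : - U * ((1 - q^k/X)*(1-q^(k+1)))
        - V * ((1 - G*q^(k+1)*X)*(1-q^(k+1))/(q*X))
        = ((μ + κ0) * ((1 - q^k/X) * (1 - G*q^(k+1)*X)) + ν) * (1 - G*q*X^2)) :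
    (u * (1-X)) * ph q G (X/q) (k+1) + (-(u*(1-X)) - v*(1-G*q*X) - κ0) * ph q G X (k+1)
      + (v*(1-G*q*X)) * ph q G (X*q) (k+1) = μ * ph q G X (k+1) + ν * ph q G X k := by
  have h1 := ph_down q G X hq hX k
  have h2 := ph_up q G X hq hX k
  have h3 := ph_succ q G X k
  have hu' : u * (1 - G*X^2) * (1 - G*q*X^2) = U := by
    rw [hu, mul_assoc, div_mul_cancel₀ _ (mul_ne_zero d0 d1)]
  have hv' : v * (1 - G*q^2*X^2) * (1 - G*q*X^2) = V := by
    rw [hv, mul_assoc, mul_comm (1 - G*q^2*X^2), div_mul_cancel₀ _ (mul_ne_zero d1 d2)]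
  apply mul_right_cancel₀ d1
  linear_combination (1 - G*q*X^2) * (u * h1 + v * h2 - (μ + κ0) * h3) + ph q G X k * hid
    - ph q G X k * ((1 - q^k/X)*(1-q^(k+1))) * hu'
    - ph q G X k * ((1 - G*q^(k+1)*X)*(1-q^(k+1))/(q*X)) * hv'

theorem sumlem (C φ φp φm μ ν ρ : ℕ → ℂ) (Pp P0 Pm : ℂ) (n : ℕ)
    (h0 : Pp * φp 0 + P0 * φ 0 + Pm * φm 0 = μ 0 * φ 0)
    (h1 : ∀ k, Pp * φp (k+1) + P0 * φ (k+1) + Pm * φm (k+1) = μ (k+1) * φ (k+1) + ν k * φ k)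
    (hC : ∀ k, k < n → C k * μ k + C (k+1) * ν k = ρ k * C k)
    (hCn : C n * μ n * φ n = ρ n * C n * φ n) :
    Pp * (∑ k ∈ Finset.range (n+1), C k * φp k) + P0 * (∑ k ∈ Finset.range (n+1), C k * φ k)
      + Pm * (∑ k ∈ Finset.range (n+1), C k * φm k)
      = ∑ k ∈ Finset.range (n+1), ρ k * C k * φ k := by
  have key : ∀ m, m ≤ n → Pp * (∑ k ∈ Finset.range (m+1), C k * φp k)
      + P0 * (∑ k ∈ Finset.range (m+1), C k * φ k)
      + Pm * (∑ k ∈ Finset.range (m+1), C k * φm k)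
      = ∑ k ∈ Finset.range m, ρ k * C k * φ k + C m * μ m * φ m := by
    intro m
    induction m with
    | zero => intro _; simp; linear_combination C 0 * h0
    | succ m ih =>
      intro hm
      have i1 := ih (by omega)
      have i2 := hC m (by omega)
      have i3 := h1 m
      rw [Finset.sum_range_succ (fun k => C k * φp k) (m+1), Finset.sum_range_succ (fun k => C k * φ k) (m+1),
        Finset.sum_range_succ (fun k => C k * φm k) (m+1),
        Finset.sum_range_succ (fun k => ρ k * C k * φ k) m]
      linear_combination i1 + C (m+1) * i3 + φ m * i2
  rw [key n le_rfl, hCn, ← Finset.sum_range_succ]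

def cf (q a b c m w : ℂ) (k : ℕ) : ℂ :=
  poch q w⁻¹ k * poch q (b*c*q*w) k * q^k /
    (poch q (q*b) k * poch q (a*b*c*q^2*m) k * poch q m⁻¹ k * poch q q k)

theorem cf_succ (q a b c m w : ℂ) (k : ℕ) :
    cf q a b c m w (k+1) = cf q a b c m w k * ((1 - q^k/w)*(1-b*c*q^(k+1)*w)*q /
      ((1-b*q^(k+1))*(1-a*b*c*q^2*m*q^k)*(1-q^k/m)*(1-q^(k+1)))) := by
  simp only [cf, poch_succ]
  rw [div_mul_div_comm]
  congr 1 <;> ring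

def S (q a b c m X : ℂ) (n : ℕ) : ℂ :=
  ∑ k ∈ Finset.range (n+1), cf q a b c m (q^n) k * ph q (a*b) X k

theorem cfstep (q a b c m w μ ν r : ℂ) (k : ℕ)
    (a1 : 1 - b*q^(k+1) ≠ 0) (a2 : 1-a*b*c*q^2*m*q^k ≠ 0)
    (a3 : 1 - q^k/m ≠ 0) (a4 : 1 - q^(k+1) ≠ 0)
    (h : ((1 - q^k/w)*(1-b*c*q^(k+1)*w)*q) * ν = (r - μ) *
      ((1-b*q^(k+1))*(1-a*b*c*q^2*m*q^k)*(1-q^k/m)*(1-q^(k+1)))) :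
    cf q a b c m w k * μ + cf q a b c m w (k+1) * ν = r * cf q a b c m w k := by
  rw [cf_succ]
  have : (1 - q^k/w)*(1-b*c*q^(k+1)*w)*q /
      ((1-b*q^(k+1))*(1-a*b*c*q^2*m*q^k)*(1-q^k/m)*(1-q^(k+1))) * ν = r - μ := by
    rw [div_mul_eq_mul_div, h, mul_div_cancel_right₀]
    exact mul_ne_zero (mul_ne_zero (mul_ne_zero a1 a2) a3) a4
  linear_combination cf q a b c m w k * this

/-- difference equation at S level -/
theorem S_diff (q a b c m X : ℂ) (n : ℕ) (hq : q ≠ 0) (hX : X ≠ 0) (hm : m ≠ 0)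
    (d0 : 1 - a*b*X^2 ≠ 0) (d1 : 1 - a*b*q*X^2 ≠ 0) (d2 : 1 - a*b*q^2*X^2 ≠ 0)
    (e1 : ∀ k, k < n → 1 - b*q^(k+1) ≠ 0) (e2 : ∀ k, k < n → 1-a*b*c*q^2*m*q^k ≠ 0)
    (e3 : ∀ k, k < n → 1 - q^k/m ≠ 0) (e4 : ∀ k, k < n → 1 - q^(k+1) ≠ 0)
    (u v : ℂ)
    (hu : u = -b*(X/m)*(1-c*m*q/X)*(1-a*b*q*X*m)*(1-a*X)/((1-a*b*X^2)*(1-a*b*q*X^2)))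
    (hv : v = (1-X/m)*(1-a*b*c*q^2*X*m)*(1-b*q*X)/((1-a*b*q*X^2)*(1-a*b*q^2*X^2))) :
    (u*(1-X)) * S q a b c m (X/q) n + (-(u*(1-X)) - v*(1-a*b*q*X) - 0) * S q a b c m X n
      + (v*(1-a*b*q*X)) * S q a b c m (X*q) n
    = -(1 - 1/q^n)*(1-b*c*q*q^n) * S q a b c m X n := by
  unfold S
  rw [sumlem (cf q a b c m (q^n)) (ph q (a*b) X) (ph q (a*b) (X/q)) (ph q (a*b) (X*q))
    (fun k => -(1-1/q^k)*(1-b*c*q*q^k))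
    (fun k => (1-1/q^(k+1))*(1-q^k/m)*(1-a*b*c*q^2*m*q^k)*(1-b*q^(k+1)))
    (fun _ => -(1 - 1/q^n)*(1-b*c*q*q^n))]
  · rw [Finset.mul_sum]; apply Finset.sum_congr rfl; intros; ring
  · simp [ph_zero]; ring
  · intro k
    refine gstep q (a*b) X u v _ _ 0 _ _ hq hX k d0 d1 d2 hu hv ?_
    simp only [pow_succ q k]
    have hK : q^k ≠ 0 := pow_ne_zero _ hq
    generalize q^k = K at *
    field_simp
    ring
  · intro k hk
    refine cfstep _ _ _ _ _ _ _ _ _ k (e1 k hk) (e2 k hk) (e3 k hk) (e4 k hk) ?_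
    have hK : q^k ≠ 0 := pow_ne_zero _ hq
    have hn : q^n ≠ 0 := pow_ne_zero _ hq
    simp only [pow_succ q k]
    generalize q^k = K at *
    generalize q^n = w at *
    field_simp
    ring
  · ring

/-- + contiguity at S level; `m` is `q^M`, polynomials on the right at `M+1` -/
theorem S_plus (q a b c m X sq : ℂ) (n : ℕ) (hq : q ≠ 0) (hX : X ≠ 0) (hm : m ≠ 0)
    (ha : a ≠ 0) (hsq : sq ≠ 0) (hsq2 : sq^2 = q*b)
    (d0 : 1 - a*b*X^2 ≠ 0) (d1 : 1 - a*b*q*X^2 ≠ 0) (d2 : 1 - a*b*q^2*X^2 ≠ 0)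
    (e1 : ∀ k, k < n → 1 - b*q^(k+1) ≠ 0) (e2 : ∀ k, k < n → 1-a*b*c*q^2*(m*q)*q^k ≠ 0)
    (e3 : ∀ k, k < n → 1 - q^k/(m*q) ≠ 0) (e4 : ∀ k, k < n → 1 - q^(k+1) ≠ 0)
    (e5 : 1 - q^n/(m*q) ≠ 0 ∨ ph q (a*b) X n = 0)
    (u v : ℂ)
    (hu : u = -sq*b*(X^2/(m*q))*(1-c*m*q/X)*(1-c*m*q^2/X)*(1-a*X)/((1-a*b*X^2)*(1-a*b*q*X^2)))
    (hv : v = -(1-a*b*c*q^2*X*m)*(1-a*b*c*q^3*X*m)*(1-b*q*X)/(a*m*q*sq)/((1-a*b*q*X^2)*(1-a*b*q^2*X^2))) :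
    (u*(1-X)) * S q a b c (m*q) (X/q) n
      + (-(u*(1-X)) - v*(1-a*b*q*X) - (1-b*c*m*q^2)*(1-a*b*c*m*q^2)/(a*m*q*sq)) * S q a b c (m*q) X n
      + (v*(1-a*b*q*X)) * S q a b c (m*q) (X*q) n
    = ∑ k ∈ Finset.range (n+1), (-(1-a*b*c*q^2*m*q^k)*(1-q^n/(m*q))*(1-b*c*q^2*m*q^n)
        /(q^n*(a*m*q*sq)*(1-q^k/(m*q)))) * cf q a b c (m*q) (q^n) k * ph q (a*b) X k := by
  unfold S
  rw [sumlem (cf q a b c (m*q) (q^n)) (ph q (a*b) X) (ph q (a*b) (X/q)) (ph q (a*b) (X*q))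
    (fun k => -(1-b*c*m*q^2*q^k)*(1-a*b*c*m*q^2*q^k)/(q^k*(a*m*q*sq)))
    (fun k => -(1-1/q^(k+1))*(1-a*b*c*q^2*m*q^k)*(1-a*b*c*q^2*(m*q)*q^k)*(1-b*q^(k+1))/(a*m*q*sq))
    (fun k => -(1-a*b*c*q^2*m*q^k)*(1-q^n/(m*q))*(1-b*c*q^2*m*q^n)
        /(q^n*(a*m*q*sq)*(1-q^k/(m*q))))]
  · simp [ph_zero]; ring
  · intro k
    refine gstep q (a*b) X u v _ _ _ _ _ hq hX k d0 d1 d2 hu hv ?_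
    simp only [pow_succ q k]
    have hK : q^k ≠ 0 := pow_ne_zero _ hq
    generalize q^k = K at *
    have hb : b = sq^2/q := by rw [hsq2]; field_simp
    subst hb
    field_simp
    ring
  · intro k hk
    refine cfstep _ _ _ _ _ _ _ _ _ k (e1 k hk) (e2 k hk) (e3 k hk) (e4 k hk) ?_
    have a3 := e3 k hk
    have hK : q^k ≠ 0 := pow_ne_zero _ hq
    have hn : q^n ≠ 0 := pow_ne_zero _ hq
    simp only [pow_succ q k]
    generalize q^k = K at *
    generalize q^n = w at *
    have key : (1-b*c*q^2*m*K)*(1-K/(m*q))/K - (1-K/w)*(1-b*c*K*q*w)/K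
        = (1-w/(m*q))*(1-b*c*q^2*m*w)/w := by
      field_simp; ring
    have h1 : q*(1-1/(K*q)) = -(1-K*q)/K := by field_simp; ring
    have hr : (-(1-a*b*c*q^2*m*K)*(1-w/(m*q))*(1-b*c*q^2*m*w)
        /(w*(a*m*q*sq)*(1-K/(m*q)))) * (1-K/(m*q)) =
        -(1-a*b*c*q^2*m*K)*((1-w/(m*q))*(1-b*c*q^2*m*w)/w)/(a*m*q*sq) := by
      generalize 1-K/(m*q) = D3 at *
      field_simp
    rw [← key] at hr
    generalize (-(1-a*b*c*q^2*m*K)*(1-w/(m*q))*(1-b*c*q^2*m*w)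
        /(w*(a*m*q*sq)*(1-K/(m*q)))) = r at *
    linear_combination (-(1 - K/w)*(1-b*c*(K*q)*w)*(1-a*b*c*q^2*m*K)*(1-a*b*c*q^2*(m*q)*K)*(1-b*(K*q))/(a*m*q*sq)) * h1
      - ((1-a*b*c*q^2*(m*q)*K)*(1-b*(K*q))*(1-K*q)) * hr
  · rcases e5 with e5 | e5
    · have hn : q^n ≠ 0 := pow_ne_zero _ hq
      generalize q^n = w at *
      have : (1-a*b*c*q^2*m*w)*(1-w/(m*q))*(1-b*c*q^2*m*w)
        /(w*(a*m*q*sq)*(1-w/(m*q))) = (1-b*c*m*q^2*w)*(1-a*b*c*m*q^2*w)/(w*(a*m*q*sq)) := by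
        rw [div_eq_div_iff (by positivity) (by positivity)]; ring
      linear_combination cf q a b c (m*q) w n * ph q (a*b) X n * this
    · rw [e5]; ring

/-- - contiguity at S level; `m*q` is `q^M`, polynomials on the right at `m = q^(M-1)` -/
theorem S_minus (q a b c m X sq : ℂ) (n : ℕ) (hq : q ≠ 0) (hX : X ≠ 0) (hm : m ≠ 0)
    (d0 : 1 - a*b*X^2 ≠ 0) (d1 : 1 - a*b*q*X^2 ≠ 0) (d2 : 1 - a*b*q^2*X^2 ≠ 0)
    (e1 : ∀ k, k < n → 1 - b*q^(k+1) ≠ 0) (e2 : ∀ k, k ≤ n → 1-a*b*c*q^2*m*q^k ≠ 0)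
    (e3 : ∀ k, k < n → 1 - q^k/m ≠ 0) (e4 : ∀ k, k < n → 1 - q^(k+1) ≠ 0)
    (u v : ℂ)
    (hu : u = -sq*(1-a*X)*(1-a*b*q*X*m)*(1-a*b*q^2*X*m)/(m*q)/((1-a*b*X^2)*(1-a*b*q*X^2)))
    (hv : v = -a*sq*m*q*(1-X/(m*q))*(1-X/m)*(1-b*q*X)/((1-a*b*q*X^2)*(1-a*b*q^2*X^2))) :
    (u*(1-X)) * S q a b c m (X/q) n
      + (-(u*(1-X)) - v*(1-a*b*q*X) - sq*(1-a*m*q)*(1/(m*q)-1)) * S q a b c m X n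
      + (v*(1-a*b*q*X)) * S q a b c m (X*q) n
    = ∑ k ∈ Finset.range (n+1), (sq*(1-q^k/(m*q))/(1-a*b*c*q^2*m*q^k)*((1-a*m*q/q^n)*(1-a*b*c*q^2*m*q^n)))
         * cf q a b c m (q^n) k * ph q (a*b) X k := by
  unfold S
  rw [sumlem (cf q a b c m (q^n)) (ph q (a*b) X) (ph q (a*b) (X/q)) (ph q (a*b) (X*q))
    (fun k => sq*(1-q^k/(m*q))*(1-a*m*q/q^k))
    (fun k => -(1-1/q^(k+1))*a*sq*(m*q)*(1-q^k/(m*q))*(1-q^k/m)*(1-b*q^(k+1)))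
    (fun k => sq*(1-q^k/(m*q))/(1-a*b*c*q^2*m*q^k)*((1-a*m*q/q^n)*(1-a*b*c*q^2*m*q^n)))]
  · simp [ph_zero]; ring
  · intro k
    refine gstep q (a*b) X u v _ _ _ _ _ hq hX k d0 d1 d2 hu hv ?_
    simp only [pow_succ q k]
    have hK : q^k ≠ 0 := pow_ne_zero _ hq
    generalize q^k = K at *
    field_simp
    ring
  · intro k hk
    refine cfstep _ _ _ _ _ _ _ _ _ k (e1 k hk) (e2 k hk.le) (e3 k hk) (e4 k hk) ?_
    have a2 := e2 k hk.le
    have hK : q^k ≠ 0 := pow_ne_zero _ hq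
    have hn : q^n ≠ 0 := pow_ne_zero _ hq
    simp only [pow_succ q k]
    generalize q^k = K at *
    generalize q^n = w at *
    generalize hD : 1-a*b*c*q^2*m*K = D at *
    field_simp
    rw [← hD]
    ring
  · have a2 := e2 n le_rfl
    generalize q^n = w at *
    generalize hD : 1-a*b*c*q^2*m*w = D at *
    field_simp

theorem p_eq (q s a b c t : ℂ) (M n x : ℕ) (hq : q ≠ 0) (hn : n ≤ M) (hx : x ≤ M) :
    p q s a b c t M n x = Om q s a b c t M n * S q a b c (q^M) (q^x) n := by
  unfold p
  rw [if_pos ⟨by omega, by omega, by omega, by omega⟩]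
  congr 1
  unfold S
  simp only [Int.toNat_natCast]
  apply Finset.sum_congr rfl
  intro k _
  have h1 : q ^ (-(n:ℤ)) = (q^n)⁻¹ := by rw [zpow_neg, zpow_natCast]
  have h2 : q ^ (-(x:ℤ)) = (q^x)⁻¹ := by rw [zpow_neg, zpow_natCast]
  have h3 : q ^ (-(M:ℤ)) = (q^M)⁻¹ := by rw [zpow_neg, zpow_natCast]
  have h4 : b * c * q ^ ((n:ℤ)+1) = b*c*q*q^n := by
    rw [zpow_add₀ hq, zpow_natCast, zpow_one]; ring
  have h5 : a * b * q ^ ((x:ℤ)+1) = a*b*q*q^x := by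
    rw [zpow_add₀ hq, zpow_natCast, zpow_one]; ring
  have h6 : a * b * c * q ^ ((M:ℤ)+2) = a*b*c*q^2*q^M := by
    rw [zpow_add₀ hq, zpow_natCast, zpow_ofNat]; ring
  rw [h1, h2, h3, h4, h5, h6]
  unfold cf ph
  ring

theorem p_zero (q s a b c t : ℂ) (M n x : ℤ) (h : ¬ (0 ≤ n ∧ n ≤ M ∧ 0 ≤ x ∧ x ≤ M)) :
    p q s a b c t M n x = 0 := by
  unfold p
  rw [if_neg h]

theorem p_mid (q s a b c t : ℂ) (M n x : ℕ) (hq : q ≠ 0) (hn : n ≤ M) (e : ℂ)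
    (h : ¬ x ≤ M → e = 0) :
    e * p q s a b c t M n x = e * (Om q s a b c t M n * S q a b c (q^M) (q^x) n) := by
  by_cases hx : x ≤ M
  · rw [p_eq _ _ _ _ _ _ _ _ _ hq hn hx]
  · rw [h hx]; simp

theorem p_up (q s a b c t : ℂ) (M n x : ℕ) (hq : q ≠ 0) (hn : n ≤ M) (e : ℂ)
    (h : ¬ x + 1 ≤ M → e = 0) :
    e * p q s a b c t M n ((x:ℤ)+1) = e * (Om q s a b c t M n * S q a b c (q^M) (q^x*q) n) := by
  have := p_mid q s a b c t M n (x+1) hq hn e h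
  rw [pow_succ q x] at this
  push_cast at this
  exact this

theorem p_dn (q s a b c t : ℂ) (M n x : ℕ) (hq : q ≠ 0) (hn : n ≤ M) (hx : x ≤ M + 1) (e : ℂ)
    (h : x = 0 → e = 0) :
    e * p q s a b c t M n ((x:ℤ)-1) = e * (Om q s a b c t M n * S q a b c (q^M) (q^x/q) n) := by
  cases x with
  | zero => rw [h rfl]; simp
  | succ x =>
    have := p_mid q s a b c t M n x hq hn e (by omega)
    rw [pow_succ, mul_div_cancel_right₀ _ hq]
    push_cast
    rw [add_sub_cancel_right]
    exact this

def gen (q : ℂ) (N : ℕ) (z : ℂ) : Prop := ∀ k : ℕ, k ≤ 2*N+5 → 1 - z*q^k ≠ 0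

theorem qpow_ne (q : ℂ) (N : ℕ) (hq : q ≠ 0) (hq1 : ∀ k : ℕ, 1 ≤ k → k ≤ N → q ^ k ≠ 1)
    (k M : ℕ) (h : k < M) (hM : M ≤ N) : 1 - q^k/q^M ≠ 0 := by
  intro h0
  apply hq1 (M-k) (by omega) (by omega)
  have e : q^M = q^(M-k) * q^k := by rw [← pow_add]; congr 1; omega
  have hk : q^k ≠ 0 := pow_ne_zero _ hq
  have hM : q^M ≠ 0 := pow_ne_zero _ hq
  have : q^M = q^k := by field_simp at h0; linear_combination h0
  rw [this] at e
  apply mul_right_cancel₀ hk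
  rw [← e, one_mul]

theorem p_diff (q s a b c t : ℂ) (N M n x : ℕ) (hq : q ≠ 0) (hM : M ≤ N) (hx : x ≤ M)
    (hq1 : ∀ k : ℕ, 1 ≤ k → k ≤ N → q ^ k ≠ 1)
    (gb : gen q N b) (gab : gen q N (a*b)) (gabc : gen q N (a*b*c)) :
    lam q (b*c) n * p q s a b c t M n x
      = ∑ ε ∈ ({-1, 0, 1} : Finset ℤ), Phi q c b a M ε x * p q s a b c t M n ((x:ℤ) - ε) := by
  rw [Finset.sum_insert (by decide), Finset.sum_insert (by decide), Finset.sum_singleton]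
  by_cases hn : n ≤ M
  swap
  · repeat rw [p_zero]
    · simp
    all_goals omega
  have hX : q^x ≠ 0 := pow_ne_zero _ hq
  have hm : q^M ≠ 0 := pow_ne_zero _ hq
  have key := S_diff q a b c (q^M) (q^x) n hq hX hm
    (by have := gab (2*x) (by omega); rwa [show (q^x)^2 = q^(2*x) by ring])
    (by have := gab (2*x+1) (by omega); rwa [show a*b*q*(q^x)^2 = a*b*q^(2*x+1) by ring])
    (by have := gab (2*x+2) (by omega); rwa [show a*b*q^2*(q^x)^2 = a*b*q^(2*x+2) by ring])
    (fun k hk => gb (k+1) (by omega))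
    (fun k hk => by
      have := gabc (2+M+k) (by omega)
      rwa [show a*b*c*q^2*q^M*q^k = a*b*c*q^(2+M+k) by ring])
    (fun k hk => qpow_ne q N hq hq1 k M (by omega) hM)
    (fun k hk => by
      have := hq1 (k+1) (by omega) (by omega)
      intro h; apply this; linear_combination -h)
    _ _ rfl rfl
  have hP : PhiP q c b a M x = (-b*(q^x/q^M)*(1-c*q^M*q/q^x)*(1-a*b*q*q^x*q^M)*(1-a*q^x)/((1-a*b*(q^x)^2)*(1-a*b*q*(q^x)^2))) * (1 - q^x) := by
    unfold PhiP
    simp only [zpow_add₀ hq, zpow_sub₀ hq, zpow_natCast, two_mul, zpow_one]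
    ring
  have hP' : PhiM q c b a M x = ((1-q^x/q^M)*(1-a*b*c*q^2*q^x*q^M)*(1-b*q*q^x)/((1-a*b*q*(q^x)^2)*(1-a*b*q^2*(q^x)^2))) * (1 - a*b*q*q^x) := by
    unfold PhiM
    simp only [zpow_add₀ hq, zpow_sub₀ hq, zpow_natCast, two_mul, zpow_one, zpow_ofNat]
    ring
  have hL : lam q (b*c) n = -(1 - 1/q^n)*(1-b*c*q*q^n) := by
    unfold lam
    simp only [zpow_add₀ hq, zpow_neg, zpow_natCast, zpow_one]
    ring
  have E1 : Phi q c b a M (-1) x = PhiM q c b a M x := by simp [Phi]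
  have E2 : Phi q c b a M 0 x = -PhiP q c b a M x - PhiM q c b a M x := by simp [Phi]
  have E3 : Phi q c b a M 1 x = PhiP q c b a M x := by simp [Phi]
  rw [E1, E2, E3, sub_neg_eq_add, sub_zero, hL, p_eq _ _ _ _ _ _ _ _ _ hq hn hx,
    p_up _ _ _ _ _ _ _ _ _ hq hn _ _, p_dn _ _ _ _ _ _ _ _ _ hq hn (by omega) _ _]
  · rw [hP, hP']
    linear_combination (- Om q s a b c t M n) * key
  · intro h; subst h; unfold PhiP; simp
  · intro h
    have : x = M := by omega
    subst this
    unfold PhiM; simp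

theorem cf_ratio (q a b c m w : ℂ) (k : ℕ) (hq : q ≠ 0)
    (h0 : poch q (q*b) k ≠ 0) (h0' : poch q q k ≠ 0)
    (h1 : poch q (a*b*c*q^2*m) k ≠ 0) (h2 : poch q (a*b*c*q^2*(m*q)) k ≠ 0)
    (h3 : poch q m⁻¹ k ≠ 0) (h4 : poch q (m*q)⁻¹ k ≠ 0) :
    cf q a b c (m*q) w k * ((1 - a*b*c*q^2*m*q^k) * (1 - (m*q)⁻¹))
      = cf q a b c m w k * ((1 - a*b*c*q^2*m)*(1 - (m*q)⁻¹*q^k)) := by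
  have s1 := poch_shift q (a*b*c*q^2*m) k
  have s2 := poch_shift q (m*q)⁻¹ k
  rw [show (m*q)⁻¹*q = m⁻¹ by field_simp] at s2
  rw [show a*b*c*q^2*m*q = a*b*c*q^2*(m*q) by ring] at s1
  unfold cf
  generalize poch q (a*b*c*q^2*(m*q)) k = PA' at *
  generalize poch q (a*b*c*q^2*m) k = PA at *
  generalize poch q (m*q)⁻¹ k = PB at *
  generalize poch q m⁻¹ k = PB' at *
  generalize poch q (q*b) k = P1 at *
  generalize poch q q k = P2 at *
  generalize poch q w⁻¹ k = P3 at *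
  generalize poch q (b*c*q*w) k = P4 at *
  rw [div_mul_eq_mul_div, div_mul_eq_mul_div, div_eq_div_iff (by positivity) (by positivity)]
  generalize 1 - a*b*c*q^2*m*q^k = A1 at *
  generalize 1 - a*b*c*q^2*m = A2 at *
  generalize 1 - (m*q)⁻¹*q^k = A3 at *
  generalize 1 - (m*q)⁻¹ = A4 at *
  linear_combination (P3*P4*q^k*P1*P2) * (PA * A1 * s2 - A3 * PB * s1)

theorem Om_eq (q s a b c t : ℂ) (n d : ℕ) (hq : q ≠ 0) (hst : s*t ≠ 0) :
    Om q s a b c t ((n+d:ℕ):ℤ) n = poch q q (n+d)/(poch q q n * poch q q d) * (1-b*c*q*(q^n)^2)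
      * poch q (q*b) n * poch q (a*b*c*q^2*q^(n+d)) n * poch q (q*a) d * (s*t)^d
      / ((s*t)^n * poch q (b*c*q*q^n) (n+d+1) * poch q (q*c) n) := by
  unfold Om binom
  rw [if_pos ⟨by omega, by omega⟩]
  have t1 : (((n+d:ℕ):ℤ) - n).toNat = d := by omega
  have t2 : (((n+d:ℕ):ℤ) + 1).toNat = n+d+1 := by omega
  have t3 : q ^ (2*(n:ℤ)+1) = q*(q^n)^2 := by
    rw [zpow_add₀ hq, two_mul, zpow_add₀ hq, zpow_natCast, zpow_one]; ring
  have t4 : a*b*c*q^(((n+d:ℕ):ℤ)+2) = a*b*c*q^2*q^(n+d) := by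
    rw [zpow_add₀ hq, zpow_natCast, zpow_ofNat]; ring
  have t5 : (s*t)^(2*(n:ℤ) - ((n+d:ℕ):ℤ)) = (s*t)^n/(s*t)^d := by
    rw [show 2*(n:ℤ) - ((n+d:ℕ):ℤ) = (n:ℤ) - d by push_cast; ring, zpow_sub₀ hst, zpow_natCast,
      zpow_natCast]
  have t6 : b*c*q^((n:ℤ)+1) = b*c*q*q^n := by
    rw [zpow_add₀ hq, zpow_natCast, zpow_one]; ring
  rw [t1, t2, t3, t4, t5, t6, Int.toNat_natCast, Int.toNat_natCast]
  have hd : (s*t)^d ≠ 0 := pow_ne_zero _ hst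
  have hn : (s*t)^n ≠ 0 := pow_ne_zero _ hst
  generalize (s*t)^d = D at *
  generalize (s*t)^n = E at *
  rw [show b*c*(q*(q^n)^2) = b*c*q*(q^n)^2 by ring]
  rw [show E/D * poch q (b*c*q*q^n) (n+d+1) * poch q (q*c) n
    = (E * poch q (b*c*q*q^n) (n+d+1) * poch q (q*c) n)/D by ring, div_div_eq_mul_div]

theorem Om_ratio (q s a b c t : ℂ) (n d : ℕ) (hq : q ≠ 0) (hst : s*t ≠ 0)
    (h1 : 1 - q*q^d ≠ 0) (h2 : 1 - b*c*q^2*q^n*q^(n+d) ≠ 0) :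
    Om q s a b c t ((n+(d+1):ℕ):ℤ) n * ((1-q*q^d)*(1-a*b*c*q^2*q^(n+d))*(1 - b*c*q^2*q^n*q^(n+d)))
      = Om q s a b c t ((n+d:ℕ):ℤ) n * ((1-q*q^(n+d))*(1-a*b*c*q^2*q^(n+d)*q^n)*(1-a*q*q^d)*(s*t)) := by
  rw [Om_eq _ _ _ _ _ _ _ _ hq hst, Om_eq _ _ _ _ _ _ _ _ hq hst]
  have s1 := poch_shift q (a*b*c*q^2*q^(n+d)) n
  rw [show n+(d+1) = n+d+1 by ring, pow_succ q (n+d), poch_succ q (b*c*q*q^n) (n+d+1),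
    poch_succ q q (n+d), poch_succ q q d, poch_succ q (q*a) d, pow_succ (s*t) d,
    show b*c*q*q^n*q^(n+d+1) = b*c*q^2*q^n*q^(n+d) by ring,
    show a*b*c*q^2*(q^(n+d)*q) = a*b*c*q^2*q^(n+d)*q by ring]
  generalize poch q (a*b*c*q^2*q^(n+d)*q) n = PA' at *
  generalize poch q (a*b*c*q^2*q^(n+d)) n = PA at *
  generalize 1 - b*c*q^2*q^n*q^(n+d) = Y at *
  generalize poch q (b*c*q*q^n) (n+d+1) = PY at *
  generalize 1 - q*q^d = Z at *
  generalize poch q q d = PZ at *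
  generalize 1 - q * q^(n+d) = W at *
  generalize poch q q (n+d) = PW at *
  generalize poch q q n = Pn at *
  generalize poch q (q*c) n = Pc at *
  generalize (1-b*c*q*(q^n)^2) = R1 at *
  generalize poch q (q*b) n = R2 at *
  generalize poch q (q*a) d = R3 at *
  rw [show 1 - q*a*q^d = 1 - a*q*q^d by ring]
  generalize 1 - a*q*q^d = R4 at *
  generalize 1 - a*b*c*q^2*q^(n+d) = A1 at *
  generalize 1 - a*b*c*q^2*q^(n+d)*q^n = A2 at *
  have e : ∀ u : ℂ, PW*W/(Pn*(PZ*Z))*R1*R2*PA'*(R3*R4)*u*(s*t)/((s*t)^n*(PY*Y)*Pc)*(Z*A1*Y)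
    = PW/(Pn*PZ)*R1*R2*(A1*PA')*R3*u/((s*t)^n*PY*Pc)*(W*R4*(s*t)) * ((Z/Z)*(Y/Y)) := by
    intro u; ring
  rw [← mul_assoc _ ((s*t)^d), e, s1, div_self h1, div_self h2]
  ring

theorem OC (q s a b c t : ℂ) (N n d k : ℕ) (hq : q ≠ 0) (hst : s*t ≠ 0) (hk : k ≤ n)
    (hN : n + d + 1 ≤ N) (hq1 : ∀ k : ℕ, 1 ≤ k → k ≤ N → q ^ k ≠ 1)
    (gb : gen q N b) (gbc : gen q N (b*c)) (gabc : gen q N (a*b*c)) :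
    Om q s a b c t ((n+(d+1):ℕ):ℤ) n * cf q a b c (q^(n+d)*q) (q^n) k
      * ((1-q*q^d)*(1 - b*c*q^2*q^n*q^(n+d))*(1-a*b*c*q^2*q^(n+d)*q^k))
    = -q*q^(n+d) * (Om q s a b c t ((n+d:ℕ):ℤ) n * cf q a b c (q^(n+d)) (q^n) k)
      * ((1-a*b*c*q^2*q^(n+d)*q^n)*(1-a*q*q^d)*(s*t)*(1-q^k/(q^(n+d)*q))) := by
  have hm : q^(n+d) ≠ 0 := pow_ne_zero _ hq
  have gabc' : ∀ l, l ≤ N → 1 - a*b*c*q^2*q^(n+d)*q^l ≠ 0 := fun l hl => by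
    have := gabc (2+(n+d)+l) (by omega)
    rwa [show a*b*c*q^2*q^(n+d)*q^l = a*b*c*q^(2+(n+d)+l) by ring]
  have qq : ∀ l, l < N → 1 - q*q^l ≠ 0 := fun l hl h => by
    apply hq1 (l+1) (by omega) (by omega)
    rw [pow_succ]; linear_combination -h
  have r1 := Om_ratio q s a b c t n d hq hst (qq d (by omega))
    (by have := gbc (2+n+(n+d)) (by omega)
        rwa [show b*c*q^2*q^n*q^(n+d) = b*c*q^(2+n+(n+d)) by ring])
  have r2 := cf_ratio q a b c (q^(n+d)) (q^n) k hq
    (poch_ne _ _ _ fun l hl => by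
      have := gb (l+1) (by omega)
      rwa [show q*b*q^l = b*q^(l+1) by ring])
    (poch_ne _ _ _ fun l hl => qq l (by omega))
    (poch_ne _ _ _ fun l hl => gabc' l (by omega))
    (poch_ne _ _ _ fun l hl => by
      have := gabc' (l+1) (by omega)
      rwa [show a*b*c*q^2*(q^(n+d)*q)*q^l = a*b*c*q^2*q^(n+d)*q^(l+1) by ring])
    (poch_ne _ _ _ fun l hl => by
      have := qpow_ne q N hq hq1 l (n+d) (by omega) (by omega)
      rwa [show (q^(n+d))⁻¹*q^l = q^l/q^(n+d) by ring])
    (poch_ne _ _ _ fun l hl => by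
      have := qpow_ne q N hq hq1 l (n+d+1) (by omega) (by omega)
      rwa [show (q^(n+d)*q)⁻¹*q^l = q^l/q^(n+d+1) by rw [pow_succ q (n+d)]; ring])
  have n1 : 1-a*b*c*q^2*q^(n+d) ≠ 0 := by simpa using gabc' 0 (by omega)
  have n2 : 1 - (q^(n+d)*q)⁻¹ ≠ 0 := by
    have := qpow_ne q N hq hq1 0 (n+d+1) (by omega) (by omega)
    rw [pow_zero, pow_succ q (n+d)] at this
    rwa [← one_div]
  have e : 1 - q*q^(n+d) = -q*q^(n+d)*(1 - (q^(n+d)*q)⁻¹) := by field_simp; ring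
  rw [e] at r1
  rw [show q^k/(q^(n+d)*q) = (q^(n+d)*q)⁻¹*q^k by ring]
  apply mul_right_cancel₀ n1
  apply mul_right_cancel₀ n2
  generalize Om q s a b c t ((n+(d+1):ℕ):ℤ) n = O' at *
  generalize Om q s a b c t ((n+d:ℕ):ℤ) n = O at *
  generalize cf q a b c (q^(n+d)*q) (q^n) k = C' at *
  generalize cf q a b c (q^(n+d)) (q^n) k = C at *
  generalize 1 - (q^(n+d)*q)⁻¹*q^k = B1 at *
  generalize 1 - (q^(n+d)*q)⁻¹ = B0 at *
  generalize 1-a*b*c*q^2*q^(n+d)*q^k = A1 at *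
  generalize 1-a*b*c*q^2*q^(n+d)*q^n = A2 at *
  generalize 1-a*b*c*q^2*q^(n+d) = A0 at *
  generalize 1 - b*c*q^2*q^n*q^(n+d) = Y at *
  generalize 1 - q*q^d = Z at *
  linear_combination C' * A1 * B0 * r1 + (O * (-q*q^(n+d)*B0*A2*(1-a*q*q^d)*(s*t))) * r2

theorem ph_vanish (q G : ℂ) (x n : ℕ) (hq : q ≠ 0) (h : x < n) : ph q G (q^x) n = 0 := by
  unfold ph poch
  rw [Finset.prod_eq_zero (Finset.mem_range.2 h), zero_mul]
  rw [inv_mul_cancel₀ (pow_ne_zero _ hq), sub_self]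

theorem p_plus (q s a b c t : ℂ) (N M n x : ℕ) (hq : q ≠ 0) (ha : a ≠ 0) (hM : M + 1 ≤ N) (hx : x ≤ M)
    (hst : s*t ≠ 0) (hst2 : (s*t)^2 = q*b)
    (hq1 : ∀ k : ℕ, 1 ≤ k → k ≤ N → q ^ k ≠ 1)
    (gb : gen q N b) (gab : gen q N (a*b)) (gbc : gen q N (b*c)) (gabc : gen q N (a*b*c)) :
    lamP q c b a M n * p q s a b c t M n x
      = ∑ ε ∈ ({-1, 0, 1} : Finset ℤ), PhiC q (s*t) c b a 1 ε M x
          * p q s a b c t ((M+1:ℕ):ℤ) n ((x:ℤ) - ε) := by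
  rw [Finset.sum_insert (by decide), Finset.sum_insert (by decide), Finset.sum_singleton]
  by_cases hn : n ≤ M + 1
  swap
  · repeat rw [p_zero]
    · simp
    all_goals omega
  have hX : q^x ≠ 0 := pow_ne_zero _ hq
  have hm : q^M ≠ 0 := pow_ne_zero _ hq
  have key := S_plus q a b c (q^M) (q^x) (s*t) n hq hX hm ha hst hst2
    (by have := gab (2*x) (by omega); rwa [show (q^x)^2 = q^(2*x) by ring])
    (by have := gab (2*x+1) (by omega); rwa [show a*b*q*(q^x)^2 = a*b*q^(2*x+1) by ring])
    (by have := gab (2*x+2) (by omega); rwa [show a*b*q^2*(q^x)^2 = a*b*q^(2*x+2) by ring])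
    (fun k hk => gb (k+1) (by omega))
    (fun k hk => by
      have := gabc (3+M+k) (by omega)
      rwa [show a*b*c*q^2*(q^M*q)*q^k = a*b*c*q^(3+M+k) by ring])
    (fun k hk => by
      rw [← pow_succ]
      exact qpow_ne q N hq hq1 k (M+1) (by omega) hM)
    (fun k hk => by
      have := hq1 (k+1) (by omega) (by omega)
      intro h; apply this; linear_combination -h)
    (by
      rw [← pow_succ]
      by_cases h : n = M+1
      · right; exact ph_vanish _ _ _ _ hq (by omega)
      · left; exact qpow_ne q N hq hq1 n (M+1) (by omega) hM)
    _ _ rfl rfl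
  have hP : PhiPp q (s*t) c b a M x = (-(s*t)*b*((q^x)^2/(q^M*q))*(1-c*q^M*q/q^x)*(1-c*q^M*q^2/q^x)*(1-a*q^x)/((1-a*b*(q^x)^2)*(1-a*b*q*(q^x)^2))) * (1 - q^x) := by
    unfold PhiPp
    simp only [zpow_add₀ hq, zpow_sub₀ hq, zpow_natCast, two_mul, zpow_one, zpow_ofNat]
    ring
  have hP' : PhiPm q (s*t) c b a M x = (-(1-a*b*c*q^2*q^x*q^M)*(1-a*b*c*q^3*q^x*q^M)*(1-b*q*q^x)/(a*q^M*q*(s*t))/((1-a*b*q*(q^x)^2)*(1-a*b*q^2*(q^x)^2))) * (1 - a*b*q*q^x) := by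
    unfold PhiPm
    simp only [zpow_add₀ hq, zpow_sub₀ hq, zpow_natCast, two_mul, zpow_one, zpow_ofNat]
    rw [div_div, div_mul_eq_mul_div]
    congr 1 <;> ring
  have hP0 : PhiP0 q (s*t) c b a M x = -PhiPp q (s*t) c b a M x - PhiPm q (s*t) c b a M x
      - (1-b*c*q^M*q^2)*(1-a*b*c*q^M*q^2)/(a*q^M*q*(s*t)) := by
    unfold PhiP0
    simp only [zpow_add₀ hq, zpow_sub₀ hq, zpow_natCast, two_mul, zpow_one, zpow_ofNat]
    ring
  have hL : lamP q c b a M n = -(1/(q^M*q)/a - 1/q^n)*(1-a*b*c*q^2*q^M*q^n) := by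
    unfold lamP
    simp only [zpow_add₀ hq, zpow_sub₀ hq, zpow_neg, zpow_natCast, zpow_one, zpow_ofNat]
    ring
  have E1 : PhiC q (s*t) c b a 1 (-1) M x = PhiPm q (s*t) c b a M x := by simp [PhiC]
  have E2 : PhiC q (s*t) c b a 1 0 M x = PhiP0 q (s*t) c b a M x := by simp [PhiC]
  have E3 : PhiC q (s*t) c b a 1 1 M x = PhiPp q (s*t) c b a M x := by simp [PhiC]
  rw [E1, E2, E3, sub_neg_eq_add, sub_zero, hL, hP0,
    p_up _ _ _ _ _ _ _ _ _ hq hn _ (by omega), p_mid _ _ _ _ _ _ _ _ _ hq hn _ (by omega),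
    p_dn _ _ _ _ _ _ _ _ _ hq hn (by omega) _ (by intro h; subst h; unfold PhiPp; simp)]
  rw [hP, hP', pow_succ q M]
  have goal2 : -(1/(q^M*q)/a - 1/q^n)*(1-a*b*c*q^2*q^M*q^n) * p q s a b c t M n x =
      Om q s a b c t ((M+1:ℕ):ℤ) n * ∑ k ∈ Finset.range (n+1), (-(1-a*b*c*q^2*q^M*q^k)*(1-q^n/(q^M*q))*(1-b*c*q^2*q^M*q^n)
        /(q^n*(a*q^M*q*(s*t))*(1-q^k/(q^M*q)))) * cf q a b c (q^M*q) (q^n) k * ph q (a*b) (q^x) k := by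
    by_cases h : n = M+1
    · rw [p_zero _ _ _ _ _ _ _ _ _ (by omega), mul_zero, Finset.sum_eq_zero, mul_zero]
      intro k _
      rw [← pow_succ, ← h, div_self (pow_ne_zero _ hq)]
      simp
    · have hn' : n ≤ M := by omega
      rw [p_eq _ _ _ _ _ _ _ _ _ hq hn' hx]
      unfold S
      rw [Finset.mul_sum, Finset.mul_sum, Finset.mul_sum]
      apply Finset.sum_congr rfl
      intro k hk
      have hkn : k ≤ n := by have := Finset.mem_range.1 hk; omega
      obtain ⟨d, rfl⟩ := Nat.exists_eq_add_of_le hn'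
      have oc := OC q s a b c t N n d k hq hst hkn hM hq1 gb gbc gabc
      rw [← add_assoc] at oc
      have nz : 1-q^k/(q^(n+d)*q) ≠ 0 := by
        rw [← pow_succ]; exact qpow_ne q N hq hq1 k _ (by omega) hM
      generalize Om q s a b c t ((n+d+1:ℕ):ℤ) n = O' at *
      generalize Om q s a b c t ((n+d:ℕ):ℤ) n = O at *
      generalize cf q a b c (q^(n+d)*q) (q^n) k = C' at *
      generalize cf q a b c (q^(n+d)) (q^n) k = C at *
      generalize ph q (a*b) (q^x) k = F at *
      generalize hB1 : 1-q^k/(q^(n+d)*q) = B1 at *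
      generalize 1-a*b*c*q^2*q^(n+d)*q^k = A1 at *
      generalize 1-a*b*c*q^2*q^(n+d)*q^n = A2 at *
      rw [show 1 - b*c*q^2*q^(n+d)*q^n = 1 - b*c*q^2*q^n*q^(n+d) by ring]
      generalize 1 - b*c*q^2*q^n*q^(n+d) = Y at *
      have hn0 : q^n ≠ 0 := pow_ne_zero _ hq
      have hd0 : q^d ≠ 0 := pow_ne_zero _ hq
      have x1 : 1 - q^n/(q^(n+d)*q) = -(1-q*q^d)/(q*q^d) := by
        rw [pow_add]; field_simp; try ring
      rw [x1]
      have x2 : -(1/(q^(n+d)*q)/a - 1/q^n) = -(1-a*q*q^d)/(q^(n+d)*q*a) := by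
        rw [pow_add]; field_simp; try ring
      rw [x2]
      have hmm : q^(n+d) ≠ 0 := hm
      have x3 : O' * (-A1 * (-(1-q*q^d)/(q*q^d))*Y/(q^n*(a*q^(n+d)*q*(s*t))*B1)*C'*F)
        = (O' * C' * ((1-q*q^d)*Y*A1)) * F/(q*q^d*q^n*(a*q^(n+d)*q*(s*t))*B1) := by ring
      rw [x3, oc]
      rw [show q*q^d*q^n = q*q^(n+d) by ring]
      generalize s*t = sq at *
      generalize q^(n+d) = m at *
      field_simp
  rw [goal2]
  linear_combination (- Om q s a b c t ((M+1:ℕ):ℤ) n) * key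

theorem p_minus (q s a b c t : ℂ) (N M n x : ℕ) (hq : q ≠ 0) (hM : M + 1 ≤ N) (hx : x ≤ M + 1)
    (hst : s*t ≠ 0)
    (hq1 : ∀ k : ℕ, 1 ≤ k → k ≤ N → q ^ k ≠ 1)
    (gb : gen q N b) (gab : gen q N (a*b)) (gbc : gen q N (b*c)) (gabc : gen q N (a*b*c)) :
    lamM q c b a ((M+1:ℕ):ℤ) n * p q s a b c t ((M+1:ℕ):ℤ) n x
      = ∑ ε ∈ ({-1, 0, 1} : Finset ℤ), PhiC q (s*t) c b a (-1) ε ((M+1:ℕ):ℤ) x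
          * p q s a b c t M n ((x:ℤ) - ε) := by
  rw [Finset.sum_insert (by decide), Finset.sum_insert (by decide), Finset.sum_singleton]
  by_cases hn : n ≤ M
  swap
  · have h0 : lamM q c b a ((M+1:ℕ):ℤ) n * p q s a b c t ((M+1:ℕ):ℤ) n x = 0 := by
      by_cases h : n = M + 1
      · subst h; unfold lamM; simp
      · rw [p_zero _ _ _ _ _ _ _ _ _ (by omega), mul_zero]
    rw [h0]
    repeat rw [p_zero]
    · simp
    all_goals omega
  have hX : q^x ≠ 0 := pow_ne_zero _ hq
  have hm : q^M ≠ 0 := pow_ne_zero _ hq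
  have dd0 : 1 - a*b*(q^x)^2 ≠ 0 := by
    have := gab (2*x) (by omega); rwa [show (q^x)^2 = q^(2*x) by ring]
  have dd1 : 1 - a*b*q*(q^x)^2 ≠ 0 := by
    have := gab (2*x+1) (by omega); rwa [show a*b*q*(q^x)^2 = a*b*q^(2*x+1) by ring]
  have dd2 : 1 - a*b*q^2*(q^x)^2 ≠ 0 := by
    have := gab (2*x+2) (by omega); rwa [show a*b*q^2*(q^x)^2 = a*b*q^(2*x+2) by ring]
  have ee2 : ∀ k, k ≤ n → 1-a*b*c*q^2*q^M*q^k ≠ 0 := fun k hk => by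
      have := gabc (2+M+k) (by omega)
      rwa [show a*b*c*q^2*q^M*q^k = a*b*c*q^(2+M+k) by ring]
  have key := S_minus q a b c (q^M) (q^x) (s*t) n hq hX hm dd0 dd1 dd2
    (fun k hk => gb (k+1) (by omega)) ee2
    (fun k hk => qpow_ne q N hq hq1 k M (by omega) (by omega))
    (fun k hk => by
      have := hq1 (k+1) (by omega) (by omega)
      intro h; apply this; linear_combination -h)
    _ _ rfl rfl
  have hP : PhiMp q (s*t) c b a ((M+1:ℕ):ℤ) x = (-(s*t)*(1-a*q^x)*(1-a*b*q*q^x*q^M)*(1-a*b*q^2*q^x*q^M)/(q^M*q)/((1-a*b*(q^x)^2)*(1-a*b*q*(q^x)^2))) * (1 - q^x) := by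
    unfold PhiMp
    push_cast
    simp only [zpow_add₀ hq, zpow_sub₀ hq, zpow_natCast, two_mul, zpow_one, zpow_ofNat]
    rw [div_div, div_mul_eq_mul_div]
    congr 1 <;> ring
  have hP' : PhiMm q (s*t) c b a ((M+1:ℕ):ℤ) x = (-a*(s*t)*q^M*q*(1-q^x/(q^M*q))*(1-q^x/q^M)*(1-b*q*q^x)/((1-a*b*q*(q^x)^2)*(1-a*b*q^2*(q^x)^2))) * (1 - a*b*q*q^x) := by
    unfold PhiMm
    rw [show (x:ℤ) - ((M+1:ℕ):ℤ) + 1 = (x:ℤ) - M by push_cast; ring]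
    push_cast
    simp only [zpow_add₀ hq, zpow_sub₀ hq, zpow_natCast, two_mul, zpow_one, zpow_ofNat]
    ring
  have hP0 : PhiM0 q (s*t) c b a ((M+1:ℕ):ℤ) x = -PhiMp q (s*t) c b a ((M+1:ℕ):ℤ) x - PhiMm q (s*t) c b a ((M+1:ℕ):ℤ) x
      - (s*t)*(1-a*q^M*q)*(1/(q^M*q)-1) := by
    unfold PhiM0
    push_cast
    simp only [zpow_add₀ hq, zpow_sub₀ hq, zpow_neg, zpow_natCast, two_mul, zpow_one, zpow_ofNat]
    ring
  have hL : lamM q c b a ((M+1:ℕ):ℤ) n = -(1/(q^M*q) - 1/q^n)*(1-b*c*q^2*q^n*q^M) := by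
    unfold lamM
    push_cast
    simp only [zpow_add₀ hq, zpow_sub₀ hq, zpow_neg, zpow_natCast, zpow_one, zpow_ofNat]
    ring
  have E1 : PhiC q (s*t) c b a (-1) (-1) ((M+1:ℕ):ℤ) x = PhiMm q (s*t) c b a ((M+1:ℕ):ℤ) x := by simp [PhiC]
  have E2 : PhiC q (s*t) c b a (-1) 0 ((M+1:ℕ):ℤ) x = PhiM0 q (s*t) c b a ((M+1:ℕ):ℤ) x := by simp [PhiC]
  have E3 : PhiC q (s*t) c b a (-1) 1 ((M+1:ℕ):ℤ) x = PhiMp q (s*t) c b a ((M+1:ℕ):ℤ) x := by simp [PhiC]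
  have v1 : ¬ x + 1 ≤ M → PhiMm q (s*t) c b a ((M+1:ℕ):ℤ) x = 0 := by
    intro h
    rw [hP']
    by_cases h' : x = M
    · subst h'; rw [div_self hX]; simp
    · have : x = M + 1 := by omega
      subst this; rw [← pow_succ, div_self hX]; simp
  have v2 : ¬ x ≤ M → PhiM0 q (s*t) c b a ((M+1:ℕ):ℤ) x = 0 := by
    intro h
    rw [hP0, v1 (by omega), hP]
    have : x = M + 1 := by omega
    subst this
    rw [pow_succ q M] at *
    have y1 : (1-a*b*q*(q^M*q)*q^M) = 1 - a*b*(q^M*q)^2 := by ring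
    have y2 : (1-a*b*q^2*(q^M*q)*q^M) = 1 - a*b*q*(q^M*q)^2 := by ring
    rw [y1, y2]
    generalize 1 - a*b*(q^M*q)^2 = D0 at *
    generalize 1 - a*b*q*(q^M*q)^2 = D1 at *
    field_simp
    ring
  rw [E1, E2, E3, sub_neg_eq_add, sub_zero, hL,
    p_up _ _ _ _ _ _ _ _ _ hq hn _ v1, p_mid _ _ _ _ _ _ _ _ _ hq hn _ v2,
    p_dn _ _ _ _ _ _ _ _ _ hq hn (by omega) _ (by intro h; subst h; unfold PhiMp; simp)]
  rw [hP0, hP, hP']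
  have goal2 : -(1/(q^M*q) - 1/q^n)*(1-b*c*q^2*q^n*q^M) * p q s a b c t ((M+1:ℕ):ℤ) n x =
      Om q s a b c t M n * ∑ k ∈ Finset.range (n+1), ((s*t)*(1-q^k/(q^M*q))/(1-a*b*c*q^2*q^M*q^k)*((1-a*q^M*q/q^n)*(1-a*b*c*q^2*q^M*q^n)))
         * cf q a b c (q^M) (q^n) k * ph q (a*b) (q^x) k := by
    rw [p_eq _ _ _ _ _ _ _ _ _ hq (by omega) hx]
    unfold S
    rw [Finset.mul_sum, Finset.mul_sum, Finset.mul_sum]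
    apply Finset.sum_congr rfl
    intro k hk
    have hkn : k ≤ n := by have := Finset.mem_range.1 hk; omega
    have A1n := ee2 k hkn
    obtain ⟨d, rfl⟩ := Nat.exists_eq_add_of_le hn
    have oc := OC q s a b c t N n d k hq hst hkn hM hq1 gb gbc gabc
    rw [← add_assoc] at oc
    rw [pow_succ q (n+d)]
    generalize Om q s a b c t ((n+d+1:ℕ):ℤ) n = O' at *
    generalize Om q s a b c t ((n+d:ℕ):ℤ) n = O at *
    generalize cf q a b c (q^(n+d)*q) (q^n) k = C' at *
    generalize cf q a b c (q^(n+d)) (q^n) k = C at *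
    generalize ph q (a*b) (q^x) k = F at *
    generalize hB1 : 1-q^k/(q^(n+d)*q) = B1 at *
    generalize 1-a*b*c*q^2*q^(n+d)*q^k = A1 at *
    generalize 1-a*b*c*q^2*q^(n+d)*q^n = A2 at *
    generalize 1 - b*c*q^2*q^n*q^(n+d) = Y at *
    have hn0 : q^n ≠ 0 := pow_ne_zero _ hq
    have hd0 : q^d ≠ 0 := pow_ne_zero _ hq
    have x1 : -(1/(q^(n+d)*q) - 1/q^n) = -(1-q*q^d)/(q^(n+d)*q) := by
      rw [pow_add]; field_simp; try ring
    have x2 : a*q^(n+d)*q/q^n = a*q*q^d := by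
      rw [pow_add]; field_simp
    rw [x1, x2]
    have x3 : -(1-q*q^d)/(q^(n+d)*q)*Y*(O'*(C'*F)) = -((O' * C' * ((1-q*q^d)*Y*A1))*F/(q^(n+d)*q)/A1) := by
      field_simp
    have x4 : -(1-q*q^d)/(q^(n+d)*q)*Y*O'*(C'*F) = -((O' * C' * ((1-q*q^d)*Y*A1))*F/(q^(n+d)*q)/A1) := by
      field_simp
    rw [x3, oc]
    generalize s*t = sq at *
    generalize q^(n+d) = m at *
    field_simp
  rw [goal2]
  linear_combination (- Om q s a b c t M n) * key

theorem conn_P (q c1 c2 c3 c4 c0 : ℂ) (N j x : ℤ) (hq : q ≠ 0)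
    (hc1 : c1 ≠ 0) (hc2 : c2 ≠ 0) (hc3 : c3 ≠ 0) (hc4 : c4 ≠ 0)
    (hc0 : c0 = (q ^ (2 * N + 3) * c1 * c2 * c3 * c4)⁻¹) :
    PhiP q c3 c2 c1 (N-j) x = -c3 * q^(N+1) * Fp q c1 c2 x * lamP q c4 c0 c3 (N-x) j := by
  have e : c4*c0*c3 = (q^(2*N+3)*c1*c2)⁻¹ := by
    have := zpow_ne_zero (2*N+3) hq
    rw [hc0]; field_simp
  unfold PhiP Fp lamP
  rw [e, mul_comm c2 c1, mul_div_assoc', div_mul_eq_mul_div]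
  congr 1
  rw [show -(N-x) - 1 = x - N - 1 by ring]
  simp only [zpow_add₀ hq, zpow_sub₀ hq, zpow_neg, two_mul, zpow_one, zpow_ofNat]
  have h1 := zpow_ne_zero N hq
  have h2 := zpow_ne_zero j hq
  have h3 := zpow_ne_zero x hq
  generalize q^N = w at *
  generalize q^j = v at *
  generalize q^x = u at *
  field_simp
  ring

theorem conn_M (q c1 c2 c3 c4 c0 : ℂ) (N j x : ℤ) (hq : q ≠ 0)
    (hc1 : c1 ≠ 0) (hc2 : c2 ≠ 0) (hc3 : c3 ≠ 0) (hc4 : c4 ≠ 0)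
    (hc0 : c0 = (q ^ (2 * N + 3) * c1 * c2 * c3 * c4)⁻¹) :
    PhiM q c3 c2 c1 (N-j) x = -c3 * q^(N+1) * Fm q c1 c2 x * lamM q c4 c0 c3 (N-x) j := by
  have e : c4*c0 = (q^(2*N+3)*c1*c2*c3)⁻¹ := by
    have := zpow_ne_zero (2*N+3) hq
    rw [hc0]; field_simp
  unfold PhiM Fm lamM
  rw [e, mul_assoc c3 c2 c1, mul_comm c2 c1, mul_div_assoc', div_mul_eq_mul_div]
  congr 1
  rw [show -(N-x) = x - N by ring]
  simp only [zpow_add₀ hq, zpow_sub₀ hq, zpow_neg, two_mul, zpow_one, zpow_ofNat]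
  have h1 := zpow_ne_zero N hq
  have h2 := zpow_ne_zero j hq
  have h3 := zpow_ne_zero x hq
  generalize q^N = w at *
  generalize q^j = v at *
  generalize q^x = u at *
  field_simp
  ring

theorem A_P (q s c1 c2 c3 c4 c0 t0 : ℂ) (N ε y x : ℤ)
    (h : (q ^ (2 * N + 3) * c4 * c0 * c3 * c1)⁻¹ = c2) :
    A q s c4 c0 c3 c1 t0 N ε 1 y x
      = -c3 * q^(N+1) * Fp q c1 c2 x * PhiC q (s*t0) c4 c0 c3 1 ε (N-x) y := by
  simp [A, Aaux, h]

theorem A_M (q s c1 c2 c3 c4 c0 t0 : ℂ) (N ε y x : ℤ)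
    (h : (q ^ (2 * N + 3) * c4 * c0 * c3 * c1)⁻¹ = c2) :
    A q s c4 c0 c3 c1 t0 N ε (-1) y x
      = -c3 * q^(N+1) * Fm q c1 c2 x * PhiC q (s*t0) c4 c0 c3 (-1) ε (N-x) y := by
  simp [A, Aaux, h]

theorem Aaux_P (q s c1 c2 c3 c4 c0 t0 : ℂ) (N ε y x : ℤ)
    (h : (q ^ (2 * N + 3) * c4 * c0 * c3 * c1)⁻¹ = c2) :
    Aaux q s c4 c0 c3 c1 t0 N ε 1 y x
      = -c3 * q^(N+1) * Fp q c1 c2 x * PhiC q (s*t0) c4 c0 c3 1 ε (N-x) y := by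
  simp [Aaux, h]

theorem Aaux_M (q s c1 c2 c3 c4 c0 t0 : ℂ) (N ε y x : ℤ)
    (h : (q ^ (2 * N + 3) * c4 * c0 * c3 * c1)⁻¹ = c2) :
    Aaux q s c4 c0 c3 c1 t0 N ε (-1) y x
      = -c3 * q^(N+1) * Fm q c1 c2 x * PhiC q (s*t0) c4 c0 c3 (-1) ε (N-x) y := by
  simp [Aaux, h]

theorem PhiC_sumP (q sq c1 c2 c3 : ℂ) (M y : ℤ) :
    ∑ e ∈ ({-1, 0, 1} : Finset ℤ), PhiC q sq c1 c2 c3 1 e M y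
     = -((1 - c1 * c2 * q ^ (M + 2)) * (1 - c1 * c2 * c3 * q ^ (M + 2)) / (c3 * q ^ (M + 1) * sq)) := by
  rw [Finset.sum_insert (by decide), Finset.sum_insert (by decide), Finset.sum_singleton]
  simp only [PhiC, PhiP0]
  simp
  ring

theorem PhiC_sumM (q sq c1 c2 c3 : ℂ) (M y : ℤ) :
    ∑ e ∈ ({-1, 0, 1} : Finset ℤ), PhiC q sq c1 c2 c3 (-1) e M y
     = -(sq * (1 - c3 * q ^ M) * (q ^ (-M) - 1)) := by
  rw [Finset.sum_insert (by decide), Finset.sum_insert (by decide), Finset.sum_singleton]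
  simp only [PhiC, PhiM0]
  simp
  ring

theorem A_0 (q s c1 c2 c3 c4 c0 t0 : ℂ) (N y x j : ℤ) (hq : q ≠ 0) (hc3 : c3 ≠ 0)
    (hst : s*t0 ≠ 0)
    (h : (q ^ (2 * N + 3) * c4 * c0 * c3 * c1)⁻¹ = c2)
    (n1 : 1 - c4*c0*q^(N+2-x) ≠ 0) (n2 : 1 - c3*q^(N-x) ≠ 0) (R : ℤ → ℂ)
    (hR : lam q (c4*c0) j * R y
      = ∑ ε ∈ ({-1, 0, 1} : Finset ℤ), Phi q c4 c0 c3 (N-x) ε y * R (y - ε)) :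
    ∑ ε ∈ ({-1, 0, 1} : Finset ℤ), A q s c4 c0 c3 c1 t0 N ε 0 y x * R (y - ε)
      = c3 * q^(N+1) * (Fp q c1 c2 x * lamP q c4 c0 c3 (N-x) j
          + Fm q c1 c2 x * lamM q c4 c0 c3 (N-x) j) * R y := by
  have B1 : A q s c4 c0 c3 c1 t0 N 1 0 y x
      = c3 * q^(N+1) * (Fp q c1 c2 x + Fm q c1 c2 x) * PhiP q c4 c0 c3 (N-x) y := by
    simp [A, Aaux, h, Phi]
  have B2 : A q s c4 c0 c3 c1 t0 N (-1) 0 y x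
      = c3 * q^(N+1) * (Fp q c1 c2 x + Fm q c1 c2 x) * PhiM q c4 c0 c3 (N-x) y := by
    simp [A, Aaux, h, Phi]
  have B1' : Aaux q s c4 c0 c3 c1 t0 N 1 0 y x
      = c3 * q^(N+1) * (Fp q c1 c2 x + Fm q c1 c2 x) * PhiP q c4 c0 c3 (N-x) y := by
    simp [Aaux, h, Phi]
  have B2' : Aaux q s c4 c0 c3 c1 t0 N (-1) 0 y x
      = c3 * q^(N+1) * (Fp q c1 c2 x + Fm q c1 c2 x) * PhiM q c4 c0 c3 (N-x) y := by
    simp [Aaux, h, Phi]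
  have B0 : A q s c4 c0 c3 c1 t0 N 0 0 y x
      = (c3 * q^(N+1) * (Fp q c1 c2 x * (lamP q c4 c0 c3 (N-x) j - lam q (c4*c0) j)
          + Fm q c1 c2 x * (lamM q c4 c0 c3 (N-x) j - lam q (c4*c0) j)))
        - c3 * q^(N+1) * (Fp q c1 c2 x + Fm q c1 c2 x)
          * (PhiP q c4 c0 c3 (N-x) y + PhiM q c4 c0 c3 (N-x) y) := by
    unfold A
    rw [if_pos ⟨rfl, rfl⟩]
    simp only [Aaux_P _ _ _ _ _ _ _ _ _ _ _ _ h, Aaux_M _ _ _ _ _ _ _ _ _ _ _ _ h,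
      ← Finset.mul_sum, PhiC_sumP, PhiC_sumM]
    rw [Finset.sum_insert (by decide), Finset.sum_singleton, B1', B2']
    have z1 : (1 - c3 * q ^ (N + 1 - x)) * (s * t0) / (1 - c4 * c0 * q ^ (N + 2 - x))
       * ((1 - c4 * c0 * q ^ (N - x + 2)) * (1 - c4 * c0 * c3 * q ^ (N - x + 2)) / (c3 * q ^ (N - x + 1) * (s*t0)))
       = - (lamP q c4 c0 c3 (N-x) j - lam q (c4*c0) j) := by
      rw [show N - x + 2 = N + 2 - x by ring]
      have : (1 - c3 * q ^ (N + 1 - x)) * (s * t0) / (1 - c4 * c0 * q ^ (N + 2 - x))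
       * ((1 - c4 * c0 * q ^ (N + 2 - x)) * (1 - c4 * c0 * c3 * q ^ (N + 2 - x)) / (c3 * q ^ (N - x + 1) * (s*t0)))
        = (1 - c3 * q ^ (N + 1 - x)) * (1 - c4 * c0 * c3 * q ^ (N + 2 - x)) / (c3 * q ^ (N - x + 1)) := by
        have := zpow_ne_zero (N-x+1) hq
        generalize s*t0 = sq at *
        generalize 1 - c4 * c0 * q ^ (N + 2 - x) = Y at *
        field_simp
      rw [this]
      unfold lamP lam
      rw [show -(N-x) - 1 = x - N - 1 by ring]
      simp only [zpow_add₀ hq, zpow_sub₀ hq, zpow_neg, two_mul, zpow_one, zpow_ofNat]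
      have h1 := zpow_ne_zero N hq
      have h2 := zpow_ne_zero j hq
      have h3 := zpow_ne_zero x hq
      generalize q^N = w at *
      generalize q^j = v at *
      generalize q^x = u at *
      field_simp
      ring
    have z2 : (1 - c4 * c0 * q ^ (N + 1 - x)) / ((1 - c3 * q ^ (N - x)) * (s * t0))
       * ((s*t0) * (1 - c3 * q ^ (N-x)) * (q ^ (-(N-x)) - 1))
       = - (lamM q c4 c0 c3 (N-x) j - lam q (c4*c0) j) := by
      have : (1 - c4 * c0 * q ^ (N + 1 - x)) / ((1 - c3 * q ^ (N - x)) * (s * t0))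
       * ((s*t0) * (1 - c3 * q ^ (N-x)) * (q ^ (-(N-x)) - 1))
        = (1 - c4 * c0 * q ^ (N + 1 - x)) * (q ^ (-(N-x)) - 1) := by
        generalize s*t0 = sq at *
        generalize 1 - c3 * q ^ (N - x) = Y at *
        field_simp
      rw [this]
      unfold lamM lam
      rw [show -(N-x) = x - N by ring]
      simp only [zpow_add₀ hq, zpow_sub₀ hq, zpow_neg, two_mul, zpow_one, zpow_ofNat]
      have h1 := zpow_ne_zero N hq
      have h2 := zpow_ne_zero j hq
      have h3 := zpow_ne_zero x hq
      generalize q^N = w at *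
      generalize q^j = v at *
      generalize q^x = u at *
      field_simp
      ring
    linear_combination (-c3 * q^(N+1) * Fp q c1 c2 x) * z1 + (-c3 * q^(N+1) * Fm q c1 c2 x) * z2
  rw [Finset.sum_insert (by decide), Finset.sum_insert (by decide), Finset.sum_singleton] at hR ⊢
  rw [B0, B1, B2]
  have E1 : Phi q c4 c0 c3 (N-x) (-1) y = PhiM q c4 c0 c3 (N-x) y := by simp [Phi]
  have E2 : Phi q c4 c0 c3 (N-x) 0 y = -PhiP q c4 c0 c3 (N-x) y - PhiM q c4 c0 c3 (N-x) y := by simp [Phi]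
  have E3 : Phi q c4 c0 c3 (N-x) 1 y = PhiP q c4 c0 c3 (N-x) y := by simp [Phi]
  rw [E1, E2, E3, sub_zero] at hR
  rw [sub_zero]
  linear_combination (- c3 * q^(N+1) * (Fp q c1 c2 x + Fm q c1 c2 x)) * hR

theorem sum3 (f : ℤ → ℂ) : ∑ e ∈ ({-1, 0, 1} : Finset ℤ), f e = f (-1) + (f 0 + f 1) := by
  rw [Finset.sum_insert (by decide), Finset.sum_insert (by decide), Finset.sum_singleton]

end qR

/-- Difference equations of the Tratnik polynomials of q-Racah type. -/
theorem tratnik_differences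
    (N : ℕ) (q s c1 c2 c3 c4 c0 t1 t2 t3 t4 t0 : ℂ)
    (hq : q ≠ 0) (hc1 : c1 ≠ 0) (hc2 : c2 ≠ 0) (hc3 : c3 ≠ 0) (hc4 : c4 ≠ 0)
    (hs : s ^ 2 = q) (ht1 : t1 ^ 2 = c1) (ht2 : t2 ^ 2 = c2) (ht3 : t3 ^ 2 = c3)
    (ht4 : t4 ^ 2 = c4)
    (hc0 : c0 = (q ^ (2 * (N : ℤ) + 3) * c1 * c2 * c3 * c4)⁻¹)
    (ht0 : t0 = (s ^ (2 * (N : ℤ) + 3) * t1 * t2 * t3 * t4)⁻¹)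
    (hgen : ∀ e0 e1 e2 e3 e4 : ℕ, e0 ≤ 1 → e1 ≤ 1 → e2 ≤ 1 → e3 ≤ 1 → e4 ≤ 1 →
      1 ≤ e0 + e1 + e2 + e3 + e4 → e0 + e1 + e2 + e3 + e4 ≤ 4 →
      ∀ k : ℤ, 0 ≤ k → k ≤ 2 * (N : ℤ) + 5 →
        c0 ^ e0 * c1 ^ e1 * c2 ^ e2 * c3 ^ e3 * c4 ^ e4 ≠ q ^ (-k))
    (hq1 : ∀ k : ℕ, 1 ≤ k → k ≤ N → q ^ k ≠ 1)
    (i j x y : ℕ) (hij : i + j ≤ N) (hxy : x + y ≤ N) :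
    (qR.lam q (c4 * c0) (j : ℤ)
          * qR.T q s c1 c2 c3 c4 t1 t2 t3 t4 (N : ℤ) (i : ℤ) (j : ℤ) (x : ℤ) (y : ℤ)
        = ∑ ε ∈ ({-1, 0, 1} : Finset ℤ),
            qR.Phi q c4 c0 c3 ((N : ℤ) - (x : ℤ)) ε (y : ℤ)
              * qR.T q s c1 c2 c3 c4 t1 t2 t3 t4 (N : ℤ) (i : ℤ) (j : ℤ) (x : ℤ) ((y : ℤ) - ε))
    ∧
    (qR.lam q (c2 * c3) (i : ℤ)
          * qR.T q s c1 c2 c3 c4 t1 t2 t3 t4 (N : ℤ) (i : ℤ) (j : ℤ) (x : ℤ) (y : ℤ)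
        = ∑ ε ∈ ({-1, 0, 1} : Finset ℤ), ∑ ε' ∈ ({-1, 0, 1} : Finset ℤ),
            qR.A q s c4 c0 c3 c1 t0 (N : ℤ) ε ε' (y : ℤ) (x : ℤ)
              * qR.T q s c1 c2 c3 c4 t1 t2 t3 t4 (N : ℤ) (i : ℤ) (j : ℤ)
                  ((x : ℤ) - ε') ((y : ℤ) - ε)) := by
  have hs0 : s ≠ 0 := by rintro rfl; apply hq; rw [← hs]; simp
  have ht10 : t1 ≠ 0 := by rintro rfl; apply hc1; rw [← ht1]; simp
  have ht20 : t2 ≠ 0 := by rintro rfl; apply hc2; rw [← ht2]; simp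
  have ht30 : t3 ≠ 0 := by rintro rfl; apply hc3; rw [← ht3]; simp
  have ht40 : t4 ≠ 0 := by rintro rfl; apply hc4; rw [← ht4]; simp
  have hqN : q ^ (2 * (N : ℤ) + 3) ≠ 0 := zpow_ne_zero _ hq
  have hsN : s ^ (2 * (N : ℤ) + 3) ≠ 0 := zpow_ne_zero _ hs0
  have ht02 : t0 ^ 2 = c0 := by
    rw [ht0, hc0, inv_pow]
    congr 1
    rw [← hs, ← ht1, ← ht2, ← ht3, ← ht4, mul_pow, mul_pow, mul_pow, mul_pow]
    congr 4
    rw [← zpow_natCast, ← zpow_natCast, ← zpow_mul, ← zpow_mul, mul_comm]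
  have ht00 : t0 ≠ 0 := by
    rw [ht0]
    exact inv_ne_zero (by positivity)
  have hst : s * t0 ≠ 0 := mul_ne_zero hs0 ht00
  have hst2 : (s * t0) ^ 2 = q * c0 := by rw [mul_pow, hs, ht02]
  have hc2' : (q ^ (2 * (N : ℤ) + 3) * c4 * c0 * c3 * c1)⁻¹ = c2 := by
    rw [hc0]; field_simp
  have hg : ∀ e0 e1 e2 e3 e4 : ℕ, e0 ≤ 1 → e1 ≤ 1 → e2 ≤ 1 → e3 ≤ 1 → e4 ≤ 1 →
      1 ≤ e0 + e1 + e2 + e3 + e4 → e0 + e1 + e2 + e3 + e4 ≤ 4 →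
      qR.gen q N (c0 ^ e0 * c1 ^ e1 * c2 ^ e2 * c3 ^ e3 * c4 ^ e4) := by
    intro e0 e1 e2 e3 e4 a0 a1 a2 a3 a4 b0 b1 k hk h
    apply hgen e0 e1 e2 e3 e4 a0 a1 a2 a3 a4 b0 b1 k (by omega) (by omega)
    rw [zpow_neg, zpow_natCast]
    exact eq_inv_of_mul_eq_one_left (by linear_combination -h)
  have g0 : qR.gen q N c0 := by simpa using hg 1 0 0 0 0
  have g3 : qR.gen q N c3 := by simpa using hg 0 0 0 1 0
  have g30 : qR.gen q N (c3 * c0) := by rw [mul_comm]; simpa using hg 1 0 0 1 0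
  have g04 : qR.gen q N (c0 * c4) := by simpa using hg 1 0 0 0 1
  have g304 : qR.gen q N (c3 * c0 * c4) := by rw [mul_comm c3]; simpa using hg 1 0 0 1 1
  have g2 : qR.gen q N c2 := by simpa using hg 0 0 1 0 0
  have g12 : qR.gen q N (c1 * c2) := by simpa using hg 0 1 1 0 0
  have g123 : qR.gen q N (c1 * c2 * c3) := by simpa using hg 0 1 1 1 0
  have hT : ∀ X Y : ℤ, qR.T q s c1 c2 c3 c4 t1 t2 t3 t4 (N : ℤ) (i : ℤ) (j : ℤ) X Y
      = qR.p q s c1 c2 c3 t2 ((N : ℤ) - j) i X * qR.p q s c3 c0 c4 t0 ((N : ℤ) - X) j Y := by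
    intro X Y
    unfold qR.T
    rw [if_pos ⟨by omega, by omega, by omega⟩, ← hc0, ← ht0]
  simp only [hT]
  have hMx : (N : ℤ) - x = ((N - x : ℕ) : ℤ) := by omega
  have hMj : (N : ℤ) - j = ((N - j : ℕ) : ℤ) := by omega
  have hRd := qR.p_diff q s c3 c0 c4 t0 N (N - x) j y hq (by omega) (by omega) hq1 g0 g30 g304
  rw [mul_comm c0 c4, ← hMx] at hRd
  refine ⟨?_, ?_⟩
  · have : ∀ ε : ℤ, qR.Phi q c4 c0 c3 ((N : ℤ) - (x : ℤ)) ε (y : ℤ)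
        * (qR.p q s c1 c2 c3 t2 ((N : ℤ) - j) i x * qR.p q s c3 c0 c4 t0 ((N : ℤ) - x) j (y - ε))
        = qR.p q s c1 c2 c3 t2 ((N : ℤ) - j) i x * (qR.Phi q c4 c0 c3 ((N : ℤ) - (x : ℤ)) ε (y : ℤ)
          * qR.p q s c3 c0 c4 t0 ((N : ℤ) - x) j (y - ε)) := fun ε => by ring
    simp only [this]
    rw [← Finset.mul_sum, ← hRd]
    ring
  · rw [Finset.sum_comm]
    have : ∀ ε' ε : ℤ, qR.A q s c4 c0 c3 c1 t0 (N : ℤ) ε ε' (y : ℤ) (x : ℤ)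
        * (qR.p q s c1 c2 c3 t2 ((N : ℤ) - j) i (x - ε')
          * qR.p q s c3 c0 c4 t0 ((N : ℤ) - (x - ε')) j (y - ε))
        = qR.p q s c1 c2 c3 t2 ((N : ℤ) - j) i (x - ε')
          * (qR.A q s c4 c0 c3 c1 t0 (N : ℤ) ε ε' (y : ℤ) (x : ℤ)
          * qR.p q s c3 c0 c4 t0 ((N : ℤ) - (x - ε')) j (y - ε)) := fun ε' ε => by ring
    simp only [this, ← Finset.mul_sum]
    clear this
    have cP := qR.conn_P q c1 c2 c3 c4 c0 N j x hq hc1 hc2 hc3 hc4 hc0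
    have cM := qR.conn_M q c1 c2 c3 c4 c0 N j x hq hc1 hc2 hc3 hc4 hc0
    have SP : qR.p q s c1 c2 c3 t2 ((N : ℤ) - j) i ((x : ℤ) - 1)
        * ∑ ε ∈ ({-1, 0, 1} : Finset ℤ), (qR.A q s c4 c0 c3 c1 t0 (N : ℤ) ε 1 (y : ℤ) (x : ℤ)
          * qR.p q s c3 c0 c4 t0 ((N : ℤ) - (x - 1)) j (y - ε))
        = qR.p q s c1 c2 c3 t2 ((N : ℤ) - j) i ((x : ℤ) - 1)
          * (qR.PhiP q c3 c2 c1 ((N : ℤ) - j) x * qR.p q s c3 c0 c4 t0 ((N : ℤ) - x) j y) := by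
      by_cases hx0 : x = 0
      · rw [qR.p_zero _ _ _ _ _ _ _ _ _ (by omega), zero_mul, zero_mul]
      · congr 1
        have h1 := qR.p_plus q s c3 c0 c4 t0 N (N - x) j y hq hc3 (by omega) (by omega) hst hst2
          hq1 g0 g30 g04 g304
        rw [show (((N - x + 1 : ℕ)) : ℤ) = (N : ℤ) - (x - 1) by omega, ← hMx] at h1
        rw [cP, mul_assoc, h1, Finset.mul_sum]
        apply Finset.sum_congr rfl
        intro ε _
        rw [qR.A_P _ _ _ _ _ _ _ _ _ _ _ _ hc2']
        ring
    have SM : qR.p q s c1 c2 c3 t2 ((N : ℤ) - j) i ((x : ℤ) - (-1))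
        * ∑ ε ∈ ({-1, 0, 1} : Finset ℤ), (qR.A q s c4 c0 c3 c1 t0 (N : ℤ) ε (-1) (y : ℤ) (x : ℤ)
          * qR.p q s c3 c0 c4 t0 ((N : ℤ) - (x - (-1))) j (y - ε))
        = qR.p q s c1 c2 c3 t2 ((N : ℤ) - j) i ((x : ℤ) - (-1))
          * (qR.PhiM q c3 c2 c1 ((N : ℤ) - j) x * qR.p q s c3 c0 c4 t0 ((N : ℤ) - x) j y) := by
      by_cases hx0 : x = N
      · rw [qR.p_zero _ _ _ _ _ _ _ _ _ (by omega), zero_mul, zero_mul]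
      · congr 1
        have h1 := qR.p_minus q s c3 c0 c4 t0 N (N - x - 1) j y hq (by omega) (by omega) hst
          hq1 g0 g30 g04 g304
        rw [show (((N - x - 1 + 1 : ℕ)) : ℤ) = (N : ℤ) - x by omega,
          show (((N - x - 1 : ℕ)) : ℤ) = (N : ℤ) - (x - (-1)) by omega] at h1
        rw [cM, mul_assoc, h1, Finset.mul_sum]
        apply Finset.sum_congr rfl
        intro ε _
        rw [qR.A_M _ _ _ _ _ _ _ _ _ _ _ _ hc2']
        ring
    have n1 : 1 - c4 * c0 * q ^ ((N : ℤ) + 2 - x) ≠ 0 := by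
      have := g04 (N - x + 2) (by omega)
      rwa [mul_comm c0, ← zpow_natCast, show ((N - x + 2 : ℕ) : ℤ) = (N : ℤ) + 2 - x by omega] at this
    have n2 : 1 - c3 * q ^ ((N : ℤ) - x) ≠ 0 := by
      have := g3 (N - x) (by omega)
      rwa [← zpow_natCast, ← hMx] at this
    have S0 := qR.A_0 q s c1 c2 c3 c4 c0 t0 N y x j hq hc3 hst hc2' n1 n2
      (fun Y => qR.p q s c3 c0 c4 t0 ((N : ℤ) - x) j Y) hRd
    refine Eq.trans ?_ (qR.sum3 _).symm
    beta_reduce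
    beta_reduce at S0
    rw [SP, SM, sub_zero, S0]
    by_cases hxj : x ≤ N - j
    · have h1 := qR.p_diff q s c1 c2 c3 t2 N (N - j) i x hq (by omega) hxj hq1 g2 g12 g123
      rw [Finset.sum_insert (by decide), Finset.sum_insert (by decide), Finset.sum_singleton,
        ← hMj, sub_zero] at h1
      have E1 : qR.Phi q c3 c2 c1 ((N : ℤ) - j) (-1) x = qR.PhiM q c3 c2 c1 ((N : ℤ) - j) x := by
        simp [qR.Phi]
      have E2 : qR.Phi q c3 c2 c1 ((N : ℤ) - j) 0 x
          = -qR.PhiP q c3 c2 c1 ((N : ℤ) - j) x - qR.PhiM q c3 c2 c1 ((N : ℤ) - j) x := by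
        simp [qR.Phi]
      have E3 : qR.Phi q c3 c2 c1 ((N : ℤ) - j) 1 x = qR.PhiP q c3 c2 c1 ((N : ℤ) - j) x := by
        simp [qR.Phi]
      rw [E1, E2, E3] at h1
      rw [← mul_assoc, h1]
      linear_combination (-qR.p q s c1 c2 c3 t2 ((N : ℤ) - j) i x
        * qR.p q s c3 c0 c4 t0 ((N : ℤ) - x) j y) * (cP + cM)
    · rw [qR.p_zero q s c3 c0 c4 t0 _ _ _ (by omega)]
      simp
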